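/- arXiv:1209.3627 — 3 statements merged into one kernel-verified Lean document; each statement's English description precedes it below -/
import Mathlib

section
/- Let p be a prime. There exists a bound Q (depending only on p) such that for every β ∈ 𝓑₋(p) and every prime q > Q with q ≡ β (mod p), there exist a prime r > q and a non-negative integer n such that the coefficient of x^n in the pqr-th cyclotomic polynomial equals β − p. -/
/-- The inverse of `b` modulo `p`, normalized to lie in `[0, p-1]`
(for `p` prime and `p ∤ b` it is the unique integer in `[1, p-1]` with `b * modInv p b ≡ 1 (mod p)`). -/
def modInv (p b : ℕ) : ℕ := ((b : ZMod p)⁻¹).val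

/-- The set `𝓑₋(p)` of integers `β` with `1 ≤ β ≤ (p-3)/2`, `p ≤ β + 2β̄ + 1` and `β > β̄`. -/
def Bminus (p : ℕ) : Finset ℕ :=
  (Finset.Icc 1 p).filter fun β =>
    2 * β + 3 ≤ p ∧ p ≤ β + 2 * modInv p β + 1 ∧ modInv p β < β

open Polynomial Finset

theorem cyclotomic_prime_mul_prime_mul {p q : ℕ} (hp : p.Prime) (hq : q.Prime) (hpq : p ≠ q) :
    cyclotomic (p * q) ℤ * ((X ^ p - 1) * (X ^ q - 1)) = (X ^ (p * q) - 1) * (X - 1) := by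
  have := Fact.mk hp
  have hdvd : ¬ q ∣ p := fun h => hpq ((Nat.prime_dvd_prime_iff_eq hq hp).1 h).symm
  have h1 := cyclotomic_prime_mul_X_sub_one ℤ p
  have h2 := cyclotomic_expand_eq_cyclotomic_mul hq hdvd ℤ
  have h3 := congrArg (expand ℤ q) h1
  simp only [map_mul, map_sub, map_pow, expand_X, map_one, h2, ← pow_mul] at h3
  rw [mul_comm p q] at *
  rw [← h3, ← h1]
  ring

theorem sum_pow_rectangle_mul (a b : ℤ[X]) {s t k l : ℕ} (hst : s ≤ t) (hkl : k ≤ l) :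
    (∑ z ∈ Ico s t ×ˢ Ico k l, a ^ z.1 * b ^ z.2) * ((a - 1) * (b - 1)) =
      (a ^ t - a ^ s) * (b ^ l - b ^ k) := by
  rw [← geom_sum_Ico_mul a hst, ← geom_sum_Ico_mul b hkl, sum_product]
  simp only [← mul_sum, ← sum_mul]
  ring

/-- The coefficients of `Φ_{pq}`, shifted by `pq` to avoid negative exponents. -/
theorem X_pow_mul_cyclotomic_prime_mul_prime {p q u v : ℕ} (hp : p.Prime) (hq : q.Prime)
    (hpq : p ≠ q) (huv : p * u + q * v = p * q + 1) (hu : u ≤ q) (hv : v ≤ p) :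
    X ^ (p * q) * cyclotomic (p * q) ℤ =
      X ^ (p * q) * ∑ z ∈ Ico 0 u ×ˢ Ico 0 v, (X ^ p) ^ z.1 * (X ^ q) ^ z.2 -
        ∑ z ∈ Ico u q ×ˢ Ico v p, (X ^ p) ^ z.1 * (X ^ q) ^ z.2 := by
  have hne : ((X ^ p - 1) * (X ^ q - 1) : ℤ[X]) ≠ 0 :=
    mul_ne_zero (X_pow_sub_C_ne_zero hp.pos 1) (X_pow_sub_C_ne_zero hq.pos 1)
  apply mul_right_cancel₀ hne
  rw [mul_assoc, cyclotomic_prime_mul_prime_mul hp hq hpq, sub_mul (X ^ (p * q) * _), mul_assoc (X ^ (p * q)),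
    sum_pow_rectangle_mul _ _ (Nat.zero_le u) (Nat.zero_le v), sum_pow_rectangle_mul _ _ hu hv]
  have h : ((X : ℤ[X]) ^ p) ^ u * (X ^ q) ^ v = X ^ (p * q) * X := by
    rw [← pow_mul, ← pow_mul, ← pow_add, huv, pow_succ]
  have h' : ((X : ℤ[X]) ^ q) ^ p = X ^ (p * q) := by rw [← pow_mul, mul_comm]
  rw [h', ← pow_mul X p q]
  linear_combination (1 - X ^ (p * q)) * h

theorem cyclotomic_mul_mul_one_sub {p q r : ℕ} (hp : p.Prime) (hq : q.Prime) (hr : r.Prime)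
    (hpq : p ≠ q) (hpr : p ≠ r) (hqr : q ≠ r) :
    cyclotomic (p * q * r) ℤ * (1 - X ^ (p * q)) =
      expand ℤ r (cyclotomic (p * q) ℤ) * ((∑ m ∈ range p, X ^ m) * (1 - X ^ q)) := by
  have hdvd : ¬ r ∣ p * q := by
    rw [hr.dvd_mul, Nat.prime_dvd_prime_iff_eq hr hp, Nat.prime_dvd_prime_iff_eq hr hq]
    tauto
  have h1 := cyclotomic_prime_mul_prime_mul hp hq hpq
  have hX : (X - 1 : ℤ[X]) ≠ 0 := X_sub_C_ne_zero 1
  apply mul_right_cancel₀ hX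
  have hg := geom_sum_mul (X : ℤ[X]) p
  rw [cyclotomic_expand_eq_cyclotomic_mul hr hdvd ℤ]
  linear_combination cyclotomic (p * q * r) ℤ * h1 +
    cyclotomic (p * q * r) ℤ * cyclotomic (p * q) ℤ * (X ^ q - 1) * hg

theorem sum_ite_add_mul_eq (N a b : ℕ) (hN : 0 < N) (J : ℕ) (hJ : b < N * J) :
    (∑ j ∈ range J, if b = a + N * j then (1 : ℤ) else 0) =
      if a ≤ b ∧ a ≡ b [MOD N] then 1 else 0 := by
  split_ifs with h
  · obtain ⟨k, hk⟩ := (Nat.modEq_iff_dvd' h.1).1 h.2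
    have hb : b = a + N * k := by omega
    have hk : k < J := by
      by_contra! hc
      have := Nat.mul_le_mul_left N hc
      omega
    rw [sum_eq_single_of_mem k (mem_range.2 hk)]
    · simp [hb]
    · intro j _ hj
      rw [if_neg]
      intro h'
      exact hj (Nat.eq_of_mul_eq_mul_left hN (by omega))
  · refine sum_eq_zero fun j _ => if_neg ?_
    rintro rfl
    exact h ⟨Nat.le_add_right _ _, by simp [Nat.ModEq]⟩

/-- The contribution of the remainder `e` to the coefficient of `x^n` in `Φ_{pqr}`. -/
def remainderTerm (p q r u v n e : ℕ) : ℤ :=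
  (∑ z ∈ Ico 0 u ×ˢ Ico 0 v,
    if r * (z.1 * p + z.2 * q) + e ≤ n ∧ r * (z.1 * p + z.2 * q) + e ≡ n [MOD p * q]
    then 1 else 0) -
  ∑ z ∈ Ico u q ×ˢ Ico v p,
    if r * (z.1 * p + z.2 * q) + e ≤ n + p * q * r ∧
      r * (z.1 * p + z.2 * q) + e ≡ n + p * q * r [MOD p * q]
    then 1 else 0

theorem coeff_expand_mul {p q r u v : ℕ} (hp : p.Prime) (hq : q.Prime)
    (hpq : p ≠ q) (huv : p * u + q * v = p * q + 1) (hu : u ≤ q) (hv : v ≤ p)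
    (n e J : ℕ) (hJ : n + p * q * r < p * q * J) :
    (X ^ (p * q * r) * expand ℤ r (cyclotomic (p * q) ℤ) *
      (X ^ e * ∑ j ∈ range J, (X ^ (p * q)) ^ j)).coeff (n + p * q * r) =
      remainderTerm p q r u v n e := by
  have h := congrArg (expand ℤ r) (X_pow_mul_cyclotomic_prime_mul_prime hp hq hpq huv hu hv)
  simp only [map_mul, map_sub, map_pow, expand_X, map_sum] at h
  have hN : 0 < p * q := Nat.mul_pos hp.pos hq.pos
  rw [mul_comm (p * q) r, pow_mul, h, sub_mul, coeff_sub, remainderTerm]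
  congr 1
  · rw [mul_sum, sum_mul, finsetSum_coeff]
    refine sum_congr rfl fun z _ => ?_
    rw [← sum_ite_add_mul_eq (p * q) _ _ hN J (by omega), mul_sum, mul_sum, finsetSum_coeff]
    refine sum_congr rfl fun j _ => ?_
    simp only [← pow_mul, ← pow_add, coeff_X_pow]
    congr 1
    rw [eq_iff_iff]
    constructor <;> intro h <;> nlinarith
  · rw [sum_mul, finsetSum_coeff]
    refine sum_congr rfl fun z _ => ?_
    rw [mul_comm (p * q) r] at hJ ⊢
    rw [← sum_ite_add_mul_eq (p * q) _ _ hN J hJ, mul_sum, mul_sum, finsetSum_coeff]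
    refine sum_congr rfl fun j _ => ?_
    simp only [← pow_mul, ← pow_add, coeff_X_pow]
    congr 1
    rw [eq_iff_iff]
    constructor <;> intro h <;> nlinarith

theorem coeff_cyclotomic_mul_mul {p q r u v : ℕ} (hp : p.Prime) (hq : q.Prime) (hr : r.Prime)
    (hpq : p ≠ q) (hpr : p ≠ r) (hqr : q ≠ r) (huv : p * u + q * v = p * q + 1)
    (hu : u ≤ q) (hv : v ≤ p) (n : ℕ) :
    (cyclotomic (p * q * r) ℤ).coeff n =
      ∑ m ∈ range p, (remainderTerm p q r u v n m - remainderTerm p q r u v n (m + q)) := by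
  have hN : 0 < p * q := Nat.mul_pos hp.pos hq.pos
  set J := n + r + 1 with hJ
  have hJ' : n + p * q * r < p * q * J := by nlinarith
  have hn : ¬ p * q * J ≤ n := by nlinarith
  have h1 : cyclotomic (p * q * r) ℤ * (1 - X ^ (p * q * J)) * X ^ (p * q * r) =
      ∑ m ∈ range p, (X ^ (p * q * r) * expand ℤ r (cyclotomic (p * q) ℤ) *
        (X ^ m * ∑ j ∈ range J, (X ^ (p * q)) ^ j) -
        X ^ (p * q * r) * expand ℤ r (cyclotomic (p * q) ℤ) *
        (X ^ (m + q) * ∑ j ∈ range J, (X ^ (p * q)) ^ j)) := by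
    have hg := geom_sum_mul_neg ((X : ℤ[X]) ^ (p * q)) J
    rw [← pow_mul] at hg
    have h2 := cyclotomic_mul_mul_one_sub hp hq hr hpq hpr hqr
    simp only [pow_add, sum_sub_distrib, ← mul_sum, ← sum_mul]
    linear_combination (-cyclotomic (p * q * r) ℤ * X ^ (p * q * r)) * hg +
      X ^ (p * q * r) * (∑ j ∈ range J, (X ^ (p * q)) ^ j) * h2
  have h2 := congrArg (fun f => f.coeff (n + p * q * r)) h1
  simp only [coeff_mul_X_pow, finsetSum_coeff, coeff_sub,
    coeff_expand_mul hp hq hpq huv hu hv n _ J hJ'] at h2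
  rw [← h2, mul_sub, mul_one, coeff_sub, coeff_mul_X_pow', if_neg hn, sub_zero]

theorem remainderTerm_eq {p q r u v n e x y : ℕ} (hp : p.Prime) (hq : q.Prime) (hpq : p ≠ q)
    (hr : r.Coprime (p * q)) (hu : u ≤ q) (hv : v ≤ p) (hx : x < q) (hy : y < p)
    (h : r * (x * p + y * q) + e ≡ n [MOD p * q]) :
    remainderTerm p q r u v n e =
      (if x < u ∧ y < v ∧ r * (x * p + y * q) + e ≤ n then 1 else 0) -
      if u ≤ x ∧ v ≤ y ∧ r * (x * p + y * q) + e ≤ n + p * q * r then 1 else 0 := by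
  have hco : p.Coprime q := (Nat.coprime_primes hp hq).2 hpq
  have key : ∀ z : ℕ × ℕ, z.1 < q → z.2 < p →
      r * (z.1 * p + z.2 * q) + e ≡ n [MOD p * q] → z = (x, y) := by
    rintro ⟨a, b⟩ ha hb hab
    have h1 : a * p + b * q ≡ x * p + y * q [MOD p * q] :=
      Nat.ModEq.cancel_left_of_coprime hr.symm (Nat.ModEq.add_right_cancel' e (hab.trans h.symm))
    have h2 : b * q ≡ y * q [MOD p] := by
      simpa [Nat.ModEq] using h1.of_mul_right q
    have h3 : a * p ≡ x * p [MOD q] := by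
      simpa [Nat.ModEq] using h1.of_mul_left p
    have h4 := (Nat.ModEq.cancel_right_of_coprime hco h2).eq_of_lt_of_lt hb hy
    have h5 := (Nat.ModEq.cancel_right_of_coprime hco.symm h3).eq_of_lt_of_lt ha hx
    rw [h4, h5]
  have h' : r * (x * p + y * q) + e ≡ n + p * q * r [MOD p * q] := by
    simpa [Nat.ModEq] using h
  unfold remainderTerm
  congr 1
  · split_ifs with hc
    · rw [sum_eq_single_of_mem (x, y) (by simp [hc.1, hc.2.1])]
      · exact if_pos ⟨hc.2.2, h⟩
      · intro z hz hne
        simp only [mem_product, mem_Ico] at hz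
        exact if_neg fun hh => hne (key z (by omega) (by omega) hh.2)
    · refine sum_eq_zero fun z hz => if_neg fun hh => hc ?_
      simp only [mem_product, mem_Ico] at hz
      have := key z (by omega) (by omega) hh.2
      subst this
      exact ⟨hz.1.2, hz.2.2, hh.1⟩
  · split_ifs with hc
    · rw [sum_eq_single_of_mem (x, y) (by simp [hc.1, hc.2.1, hx, hy])]
      · exact if_pos ⟨hc.2.2, h'⟩
      · intro z hz hne
        simp only [mem_product, mem_Ico] at hz
        refine if_neg fun hh => hne (key z (by omega) (by omega) ?_)
        simpa [Nat.ModEq] using hh.2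
    · refine sum_eq_zero fun z hz => if_neg fun hh => hc ?_
      simp only [mem_product, mem_Ico] at hz
      have := key z (by omega) (by omega) (by simpa [Nat.ModEq] using hh.2)
      subst this
      exact ⟨hz.1.1, hz.2.1, hh.1⟩

theorem exists_natCast_zmod_eq_mem_Ico {N : ℕ} [NeZero N] (a : ZMod N) (L : ℕ) :
    ∃ n : ℕ, L ≤ n ∧ n < L + N ∧ (n : ZMod N) = a :=
  ⟨L + (a - (L : ZMod N)).val, by omega, by have := ZMod.val_lt (a - (L : ZMod N)); omega, by simp⟩

theorem sum_neg_ite_lt_sub_ite_le {p s t : ℕ} (hs : s ≤ p) (ht : t ≤ p) :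
    ∑ m ∈ range p, (-(if m < s then (1 : ℤ) else 0) - if t ≤ m then 1 else 0) =
      -s - (p - t) := by
  have h1 : {m ∈ range p | m < s} = range s := by ext; simp; omega
  have h2 : {m ∈ range p | t ≤ m} = Ico t p := by ext; simp; omega
  rw [sum_sub_distrib, sum_neg_distrib, sum_boole, sum_boole, h1, h2, card_range, Nat.card_Ico,
    Nat.cast_sub ht]

theorem exists_prime_gt_mul_eq_one {p q d : ℕ} (hp : p.Prime) (hq : q.Prime) (hpq : p ≠ q)
    (hd : 0 < d) (hdq : d < q) (B : ℕ) :
    ∃ r : ℕ, B < r ∧ r.Prime ∧ (r : ZMod (p * q)) * (d * p - q) = 1 := by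
  have : NeZero (p * q) := ⟨(Nat.mul_pos hp.pos hq.pos).ne'⟩
  have hco : p.Coprime q := (Nat.coprime_primes hp hq).2 hpq
  have h1 : IsCoprime ((d : ℤ) * p - q) ((p * q : ℕ) : ℤ) := by
    rw [Nat.cast_mul]
    have hpq' : IsCoprime (p : ℤ) q := Nat.isCoprime_iff_coprime.2 hco
    have hdq' : IsCoprime (d : ℤ) q :=
      Nat.isCoprime_iff_coprime.2 ((hq.coprime_iff_not_dvd.2 (Nat.not_dvd_of_pos_of_lt hd hdq)).symm)
    refine IsCoprime.mul_right ?_ ?_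
    · have := hpq'.symm.neg_left.add_mul_left_left (d : ℤ)
      rwa [show -(q : ℤ) + p * d = d * p - q by ring] at this
    · have := (hdq'.mul_left hpq').add_mul_left_left (-1 : ℤ)
      rwa [show (d : ℤ) * p + q * -1 = d * p - q by ring] at this
  have h2 : IsUnit ((d : ZMod (p * q)) * p - q) := by
    have := (ZMod.coe_int_isUnit_iff_isCoprime ((d : ℤ) * p - q) (p * q)).2 h1.symm
    simpa using this
  obtain ⟨a, ha⟩ := h2
  obtain ⟨r, hr1, hr2, hr3⟩ := Nat.forall_exists_prime_gt_and_eq_mod (a⁻¹).isUnit B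
  refine ⟨r, hr1, hr2, ?_⟩
  rw [hr3, ← ha, Units.inv_mul]

theorem exists_mul_mem_Ioc (a : ℕ) {b : ℕ} (hb : 0 < b) : ∃ d : ℕ, a < d * b ∧ d * b ≤ a + b := by
  refine ⟨a / b + 1, ?_, ?_⟩
  · rw [mul_comm]
    exact Nat.lt_mul_div_succ a hb
  · rw [add_mul, one_mul]
    exact Nat.add_le_add_right (Nat.div_mul_le_self a b) b

theorem exists_coeff_cyclotomic_eq {p q β v N K : ℕ} (hp : p.Prime) (hq : q.Prime)
    (hpN : p = N + 1 + β) (hNK : N = K + β) (hKv : K + 1 ≤ v) (hvβ : v < β)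
    (hqβ : q ≡ β [MOD p]) (hqv : q * v ≡ 1 [MOD p]) (hqN : p * N + p + 1 ≤ q) :
    ∃ r : ℕ, r.Prime ∧ q < r ∧ ∃ n : ℕ,
      (cyclotomic (p * q * r) ℤ).coeff n = (β : ℤ) - p := by
  have hp0 := hp.pos
  have hN0 : 0 < N := by omega
  have hpq : p < q := by nlinarith
  have : NeZero (p * q) := ⟨(Nat.mul_pos hp.pos hq.pos).ne'⟩
  -- the partition `p * u + q * v = p * q + 1`
  obtain ⟨u, huv⟩ : ∃ u : ℕ, p * u + q * v = p * q + 1 := by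
    have h1 : q * v ≤ p * q + 1 := by nlinarith
    have h2 : q * v ≡ p * q + 1 [MOD p] := by simpa [Nat.ModEq] using hqv
    obtain ⟨u, hu⟩ := (Nat.modEq_iff_dvd' h1).1 h2
    exact ⟨u, by omega⟩
  have hvp : v ≤ p := by omega
  have huq : u ≤ q := by
    by_contra! h
    nlinarith
  -- the common difference
  obtain ⟨d, hd1, hd2⟩ := exists_mul_mem_Ioc (K * q) (Nat.mul_pos hp0 hN0)
  have hd0 : 0 < d := by
    rcases Nat.eq_zero_or_pos d with rfl | h
    · simp at hd1
    · exact h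
  have hdp : d * p < q := by
    by_contra! h
    have h1 := Nat.mul_le_mul_right N h
    nlinarith
  have hdq : d < q := by nlinarith
  obtain ⟨r, hr, hrp, hr1⟩ := exists_prime_gt_mul_eq_one hp hq hpq.ne hd0 hdq (2 * (p * q) + p + q)
  have hqr : q < r := by omega
  have hrco : r.Coprime (p * q) := by
    refine Nat.Coprime.mul_right ?_ ?_
    · exact (Nat.coprime_primes hrp hp).2 (by omega)
    · exact (Nat.coprime_primes hrp hq).2 (by omega)
  -- the threshold `T = β * q - p - 1`
  obtain ⟨T, hT⟩ : ∃ T : ℕ, T + p + 1 = β * q := by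
    have : p + 1 ≤ β * q := by nlinarith
    exact ⟨β * q - (p + 1), by omega⟩
  obtain ⟨n, hn1, hn2, hn3⟩ := exists_natCast_zmod_eq_mem_Ico (N := p * q)
    ((r : ZMod (p * q)) * ((β : ZMod (p * q)) * d * p - p - β * q)) (r * T + p + q)
  have hn4 : n < r * (T + 1) := by nlinarith
  have hpq0 : (p : ZMod (p * q)) * q = 0 := by
    rw [← Nat.cast_mul, ZMod.natCast_self]
  have hqq : (q : ZMod (p * q)) * q = β * q := by
    rw [← Nat.cast_mul, ← Nat.cast_mul, ZMod.natCast_eq_natCast_iff]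
    exact hqβ.mul_right' q
  have hpc : (p : ZMod (p * q)) = N + 1 + β := by
    simpa using congrArg (Nat.cast (R := ZMod (p * q))) hpN
  refine ⟨r, hrp, hqr, n, ?_⟩
  rw [coeff_cyclotomic_mul_mul hp hq hrp hpq.ne (by omega) (by omega) huv huq hvp n]
  have hterm : ∀ m ∈ range p,
      remainderTerm p q r u v n m - remainderTerm p q r u v n (m + q) =
        -(if m < v then (1 : ℤ) else 0) - if β + v ≤ m then 1 else 0 := by
    intro m hm
    have hmp := mem_range.1 hm
    rcases lt_or_ge m β with hmβ | hmβ
    · obtain ⟨k, hk, rfl⟩ : ∃ k, 0 < k ∧ β = m + k := ⟨β - m, by omega, by omega⟩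
      obtain ⟨x, hx⟩ : ∃ x, x + 1 = k * d := ⟨k * d - 1, Nat.sub_add_cancel (Nat.mul_pos hk hd0)⟩
      have hxu : x < u := by
        have h1 := Nat.mul_le_mul_left k hdp.le
        have h2 : (m + k + v) * q ≤ p * q := Nat.mul_le_mul_right q (by omega)
        have h3 := congrArg (p * ·) hx
        by_contra! h
        have h4 := Nat.mul_le_mul_left p h
        linarith [Nat.zero_le (m * q)]
      rw [remainderTerm_eq (x := x) (y := N + 1 + m) hp hq hpq.ne hrco huq hvp (by omega)
        (by omega) ?_, remainderTerm_eq (x := x) (y := m) hp hq hpq.ne hrco huq hvp (by omega)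
        (by omega) ?_]
      · have hT' : x * p + m * q ≤ T := by
          have h1 := Nat.mul_le_mul_left k (Nat.succ_le_of_lt hdp)
          have h2 := congrArg (· * p) hx
          simp only [Nat.succ_eq_add_one] at h1 h2
          linarith
        have h1 := Nat.mul_le_mul_left r hT'
        have h2 : r * (x * p + m * q) + (m + q) ≤ n := by omega
        have h3 : ¬ (N + 1 + m < v) := by omega
        have h4 : ¬ (u ≤ x) := by omega
        have h5 : ¬ (m + k + v ≤ m) := by omega
        simp [h2, h3, h4, h5, hxu]
      · have hxc : (x : ZMod (p * q)) + 1 = k * d := by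
          simpa using congrArg (Nat.cast (R := ZMod (p * q))) hx
        rw [← ZMod.natCast_eq_natCast_iff]
        push_cast at hn3 hqq ⊢
        linear_combination r * p * hxc - (m + q) * hr1 - hn3 + r * d * hpq0 - r * hqq
      · have hxc : (x : ZMod (p * q)) + 1 = k * d := by
          simpa using congrArg (Nat.cast (R := ZMod (p * q))) hx
        rw [← ZMod.natCast_eq_natCast_iff]
        push_cast at hn3 hpc ⊢
        linear_combination r * p * hxc - r * q * hpc + r * hpq0 - m * hr1 - hn3
    · obtain ⟨k, rfl⟩ := Nat.exists_eq_add_of_le hmβ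
      have hkN : k ≤ N := by omega
      have hkd : u + k * d + 1 ≤ q := by
        have h1 := Nat.mul_le_mul_right (d * p) hkN
        have h2 := Nat.mul_le_mul_left q hKv
        by_contra! h
        have h3 := Nat.mul_le_mul_left p (Nat.le_of_lt_succ h)
        linarith
      obtain ⟨x, hx⟩ := Nat.exists_eq_add_of_le hkd
      have hux : u ≤ x + u := by omega
      rw [remainderTerm_eq (x := x + u) (y := k) hp hq hpq.ne hrco huq hvp (by omega)
        (by omega) ?_, remainderTerm_eq (x := x + u) (y := β + k) hp hq hpq.ne hrco huq hvp
        (by omega) (by omega) ?_]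
      · have h1 : ¬ (r * ((x + u) * p + (β + k) * q) + (β + k + q) ≤ n + p * q * r) := by
          have hT' : T + 1 + p * q ≤ (x + u) * p + (β + k) * q := by
            have h2 := Nat.mul_le_mul_left k hdp.le
            have h3 := congrArg (· * p) hx
            linarith
          have h2 := Nat.mul_le_mul_left r hT'
          intro h3
          linarith
        have h2 : v ≤ k → r * ((x + u) * p + k * q) + (β + k) ≤ n + p * q * r := by
          intro _
          have hT' : (x + u) * p + k * q ≤ T + p * q := by
            have h2 := congrArg (· * p) hx
            obtain ⟨s, hs⟩ := Nat.exists_eq_add_of_le hdp.le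
            have h3 : k * s ≤ N * s := Nat.mul_le_mul_right s hkN
            have h4 : k * q = k * (d * p) + k * s := by rw [hs]; ring
            have h5 : N * q = N * (d * p) + N * s := by rw [hs]; ring
            have h6 : N * q = K * q + β * q := by rw [hNK]; ring
            linarith
          have h3 := Nat.mul_le_mul_left r hT'
          linarith
        have h3 : ¬ (β + k < v) := by omega
        by_cases hvk : v ≤ k
        · simp [h1, h2 hvk, h3, hvk]
        · simp [h1, h3, hvk]
      · have hxc : (q : ZMod (p * q)) = u + k * d + 1 + x := by
          simpa using congrArg (Nat.cast (R := ZMod (p * q))) hx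
        rw [← ZMod.natCast_eq_natCast_iff]
        push_cast
        linear_combination r * hpq0 - (β + k + q) * hr1 - r * p * hxc - hn3 +
          r * d * hpq0 - r * hqq
      · have hxc : (q : ZMod (p * q)) = u + k * d + 1 + x := by
          simpa using congrArg (Nat.cast (R := ZMod (p * q))) hx
        rw [← ZMod.natCast_eq_natCast_iff]
        push_cast
        linear_combination r * hpq0 - (β + k) * hr1 - r * p * hxc - hn3
  rw [sum_congr rfl hterm, sum_neg_ite_lt_sub_ite_le hvp (by omega)]
  push_cast
  ring

theorem stmt_1 (p : ℕ) (hp : p.Prime) :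
    ∃ Q : ℕ, ∀ β ∈ Bminus p, ∀ q : ℕ, q.Prime → Q < q → q ≡ β [MOD p] →
      ∃ r : ℕ, r.Prime ∧ q < r ∧ ∃ n : ℕ,
        (Polynomial.cyclotomic (p * q * r) ℤ).coeff n = (β : ℤ) - (p : ℤ) := by
  refine ⟨p * p + p + 1, fun β hβ q hq hQ hqβ => ?_⟩
  simp only [Bminus, mem_filter, mem_Icc] at hβ
  obtain ⟨⟨hβ1, -⟩, hβ3, hβ4, hβ5⟩ := hβ
  have hqv : q * modInv p β ≡ 1 [MOD p] := by
    have : Fact p.Prime := ⟨hp⟩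
    have hβ0 : (β : ZMod p) ≠ 0 := by
      rw [Ne, ZMod.natCast_eq_zero_iff]
      exact Nat.not_dvd_of_pos_of_lt hβ1 (by omega)
    refine (hqβ.mul_right _).trans ?_
    rw [← ZMod.natCast_eq_natCast_iff]
    simp [modInv, hβ0]
  refine exists_coeff_cyclotomic_eq (N := p - 1 - β) (K := p - 1 - 2 * β) hp hq (by omega)
    (by omega) (by omega) hβ5 hqβ hqv ?_
  have := Nat.mul_le_mul_left p (show p - 1 - β ≤ p by omega)
  omega
end

section
/- Let p be a prime. There exists a bound Q (depending only on p) such that for every β ∈ 𝓑₊(p) and every prime q > Q with q ≡ β (mod p), there exist a prime r > q and a non-negative integer n such that the coefficient of x^n in the pqr-th cyclotomic polynomial equals p − β. -/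
/-- The set `𝓑₊(p)` of integers `β` with `1 ≤ β ≤ (p-3)/2`, `β + β̄ ≥ p` and `β̄ ≤ 2β`. -/
def Bplus (p : ℕ) : Finset ℕ :=
  (Finset.Icc 1 p).filter fun β =>
    2 * β + 3 ≤ p ∧ p ≤ β + modInv p β ∧ modInv p β ≤ 2 * β

open Polynomial Finset

/-- The linear functional summing the coefficients of index `m ≤ n`, `m ≡ n (mod N)`. -/
noncomputable def classSum (N n : ℕ) : ℤ[X] →ₗ[ℤ] ℤ :=
  ∑ m ∈ (range (n + 1)).filter (· ≡ n [MOD N]), Polynomial.lcoeff ℤ m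

theorem classSum_X_pow (N n m : ℕ) :
    classSum N n (X ^ m) = if m ≤ n ∧ m ≡ n [MOD N] then 1 else 0 := by
  simp [classSum, LinearMap.sum_apply, Polynomial.coeff_X_pow]

theorem classSum_mul_one_sub_X_pow {N : ℕ} (hN : 0 < N) (n : ℕ) (P : ℤ[X]) :
    classSum N n (P * (1 - X ^ N)) = P.coeff n := by
  have hmod : ∀ k, k + N ≡ n [MOD N] ↔ k ≡ n [MOD N] := fun k => by simp [Nat.ModEq]
  have h : classSum N n ∘ₗ LinearMap.mulRight ℤ (1 - X ^ N : ℤ[X]) = Polynomial.lcoeff ℤ n := by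
    refine Polynomial.lhom_ext' fun k => LinearMap.ext_ring ?_
    simp only [LinearMap.comp_apply, LinearMap.mulRight_apply, Polynomial.lcoeff_apply,
      Polynomial.monomial_one_right_eq_X_pow, mul_sub, mul_one, ← pow_add, map_sub,
      classSum_X_pow, Polynomial.coeff_X_pow, hmod]
    by_cases hk : k ≡ n [MOD N]
    · by_cases h1 : k + N ≤ n
      · rw [if_pos ⟨by omega, hk⟩, if_pos ⟨h1, hk⟩, if_neg (by omega), sub_self]
      · by_cases h2 : k ≤ n
        · have hkn : n = k := by
            obtain ⟨c, hc⟩ := (Nat.modEq_iff_dvd' h2).1 hk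
            rcases Nat.eq_zero_or_pos c with rfl | hc0
            · omega
            · have := Nat.le_mul_of_pos_right N hc0
              omega
          simp [hkn, hN.ne', Nat.ModEq.refl]
        · rw [if_neg (by omega), if_neg (by omega), if_neg (by omega), sub_self]
    · have hkn : n ≠ k := fun h => hk (h ▸ Nat.ModEq.refl _)
      simp [hk, hkn]
  exact LinearMap.congr_fun h P

theorem cyclotomic_mul_prime_mul {p q : ℕ} (hp : p.Prime) (hq : q.Prime) (hpq : p ≠ q) :
    cyclotomic (p * q) ℤ * ((∑ i ∈ range p, X ^ i) * (1 - X ^ q)) = 1 - X ^ (p * q) := by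
  have := Fact.mk hp
  have := Fact.mk hq
  have h1 := cyclotomic_expand_eq_cyclotomic_mul (n := q) hp
    (fun h => hpq ((Nat.prime_dvd_prime_iff_eq hp hq).1 h)) ℤ
  have h2 := congrArg (expand ℤ p) (cyclotomic_prime_mul_X_sub_one ℤ q)
  have h3 := cyclotomic_prime_mul_X_sub_one ℤ p
  have h4 := cyclotomic_prime_mul_X_sub_one ℤ q
  simp only [map_mul, map_sub, map_pow, expand_X, map_one, h1, ← pow_mul] at h2
  rw [mul_comm q p] at h2
  rw [← cyclotomic_prime]
  linear_combination (-1 : ℤ[X]) * h2 - cyclotomic (p * q) ℤ * cyclotomic q ℤ * h3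
    + cyclotomic (p * q) ℤ * cyclotomic p ℤ * h4

theorem cyclotomic_mul_prime_eq {p q ρ σ : ℕ} (hp : p.Prime) (hq : q.Prime) (hpq : p ≠ q)
    (hρ : ρ ≤ q) (hσ : σ ≤ p) (h : ρ * p + σ * q = p * q + 1) :
    cyclotomic (p * q) ℤ =
      (∑ a ∈ range ρ, ∑ b ∈ range σ, X ^ (a * p + b * q)) -
        ∑ a ∈ Ico ρ q, ∑ b ∈ Ico σ p, X ^ (a * p + b * q - p * q) := by
  have hA : (∑ a ∈ range ρ, ∑ b ∈ range σ, (X : ℤ[X]) ^ (a * p + b * q)) =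
      (∑ a ∈ range ρ, (X ^ p) ^ a) * ∑ b ∈ range σ, (X ^ q) ^ b := by
    rw [sum_mul_sum]
    refine sum_congr rfl fun a _ => sum_congr rfl fun b _ => ?_
    rw [← pow_mul, ← pow_mul, ← pow_add, mul_comm a, mul_comm b]
  have hB : X ^ (p * q) * (∑ a ∈ Ico ρ q, ∑ b ∈ Ico σ p, (X : ℤ[X]) ^ (a * p + b * q - p * q)) =
      (∑ a ∈ Ico ρ q, (X ^ p) ^ a) * ∑ b ∈ Ico σ p, (X ^ q) ^ b := by
    rw [sum_mul_sum, mul_sum]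
    refine sum_congr rfl fun a ha => ?_
    rw [mul_sum]
    refine sum_congr rfl fun b hb => ?_
    rw [mem_Ico] at ha hb
    have := Nat.mul_le_mul_right p ha.1
    have := Nat.mul_le_mul_right q hb.1
    rw [← pow_mul, ← pow_mul, ← pow_add, ← pow_add]
    congr 1
    rw [mul_comm p a, mul_comm q b]
    omega
  have hne : ∀ {m : ℕ}, 0 < m → (X ^ m - 1 : ℤ[X]) ≠ 0 := fun hm => by
    simpa using X_pow_sub_C_ne_zero hm (1 : ℤ)
  apply mul_right_cancel₀ (hne hp.pos)
  apply mul_right_cancel₀ (hne hq.pos)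
  apply mul_left_cancel₀ (pow_ne_zero (p * q) (X_ne_zero (R := ℤ)))
  have h1 := cyclotomic_mul_prime_mul hp hq hpq
  have h2 := geom_sum_mul (X : ℤ[X]) p
  have h3 := geom_sum_mul (X ^ p : ℤ[X]) ρ
  have h4 := geom_sum_mul (X ^ q : ℤ[X]) σ
  have h5 := geom_sum_Ico_mul (X ^ p : ℤ[X]) hρ
  have h6 := geom_sum_Ico_mul (X ^ q : ℤ[X]) hσ
  have h7 : (X ^ p : ℤ[X]) ^ ρ * (X ^ q) ^ σ = X ^ (p * q) * X := by
    rw [← pow_mul, ← pow_mul, ← pow_add, ← pow_succ, mul_comm p ρ, mul_comm q σ, h]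
  have h8 : (X ^ p : ℤ[X]) ^ q = X ^ (p * q) := by rw [pow_mul]
  have h9 : (X ^ q : ℤ[X]) ^ p = X ^ (p * q) := by rw [← pow_mul, mul_comm]
  rw [h8] at h5
  rw [h9] at h6
  have hl : cyclotomic (p * q) ℤ * (X ^ p - 1) * (X ^ q - 1) = (X ^ (p * q) - 1) * (X - 1) := by
    linear_combination (-(X - 1) : ℤ[X]) * h1 - cyclotomic (p * q) ℤ * (X ^ q - 1) * h2
  have hAl : (∑ a ∈ range ρ, ∑ b ∈ range σ, (X : ℤ[X]) ^ (a * p + b * q)) *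
      (X ^ p - 1) * (X ^ q - 1) = ((X ^ p) ^ ρ - 1) * ((X ^ q) ^ σ - 1) := by
    rw [← h3, ← h4, hA]
    ring
  have hBl : X ^ (p * q) * (∑ a ∈ Ico ρ q, ∑ b ∈ Ico σ p,
      (X : ℤ[X]) ^ (a * p + b * q - p * q)) * (X ^ p - 1) * (X ^ q - 1) =
        (X ^ (p * q) - (X ^ p) ^ ρ) * (X ^ (p * q) - (X ^ q) ^ σ) := by
    rw [← h5, ← h6, hB]
    ring
  linear_combination (X ^ (p * q) : ℤ[X]) * hl - X ^ (p * q) * hAl + hBl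
    + (1 - X ^ (p * q)) * h7

theorem cyclotomic_three_primes_mul {p q r : ℕ} (hp : p.Prime) (hq : q.Prime) (hr : r.Prime)
    (hpq : p ≠ q) (hpr : p ≠ r) (hqr : q ≠ r) :
    cyclotomic (p * q * r) ℤ * (1 - X ^ (p * q)) =
      expand ℤ r (cyclotomic (p * q) ℤ) * ((∑ i ∈ range p, X ^ i) * (1 - X ^ q)) := by
  have hdvd : ¬ r ∣ p * q := by
    rw [hr.dvd_mul, Nat.prime_dvd_prime_iff_eq hr hp, Nat.prime_dvd_prime_iff_eq hr hq]
    tauto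
  rw [cyclotomic_expand_eq_cyclotomic_mul hr hdvd, mul_assoc (cyclotomic (p * q * r) ℤ),
    cyclotomic_mul_prime_mul hp hq hpq]

theorem classSum_expand_mul (N n p q r : ℕ) (s t : Finset ℕ) (k : ℕ → ℕ → ℕ) :
    classSum N n (expand ℤ r (∑ a ∈ s, ∑ b ∈ t, X ^ k a b) *
        ((∑ i ∈ range p, X ^ i) * (1 - X ^ q))) =
      ∑ i ∈ range p,
        ((∑ a ∈ s, ∑ b ∈ t, classSum N n (X ^ (r * k a b + i))) -
          ∑ a ∈ s, ∑ b ∈ t, classSum N n (X ^ (r * k a b + (q + i)))) := by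
  simp only [← map_sum, ← map_sub]
  congr 1
  rw [← mul_assoc, mul_sum, sum_mul]
  refine sum_congr rfl fun i _ => ?_
  simp only [map_sum, map_pow, expand_X, pow_add, pow_mul, ← sum_mul]
  ring

theorem sum_sum_classSum {N n r e a₀ b₀ : ℕ} {s t : Finset ℕ} {k : ℕ → ℕ → ℕ}
    (h : ∀ a ∈ s, ∀ b ∈ t, r * k a b + e ≡ n [MOD N] ↔ a = a₀ ∧ b = b₀) :
    ∑ a ∈ s, ∑ b ∈ t, classSum N n (X ^ (r * k a b + e)) =
      if a₀ ∈ s ∧ b₀ ∈ t ∧ r * k a₀ b₀ + e ≤ n then 1 else 0 := by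
  have h1 : ∀ a ∈ s, ∀ b ∈ t, classSum N n (X ^ (r * k a b + e)) =
      if a = a₀ then if b = b₀ then if r * k a₀ b₀ + e ≤ n then 1 else 0 else 0 else 0 := by
    intro a ha b hb
    simp only [classSum_X_pow, h a ha b hb]
    by_cases h1 : a = a₀ <;> by_cases h2 : b = b₀ <;> simp [h1, h2]
  rw [sum_congr rfl fun a ha => sum_congr rfl (h1 a ha)]
  by_cases h1 : a₀ ∈ s <;> by_cases h2 : b₀ ∈ t <;> simp [h1, h2, sum_ite_irrel]

theorem mul_add_modEq_iff {p q r α n x₀ y₀ : ℕ} (hpq : p.Coprime q)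
    (hα : r * p * α ≡ 1 [MOD q]) (hr : r * q + 1 ≡ 0 [MOD p])
    (hn : n ≡ r * (x₀ * p + y₀ * q) [MOD p * q]) (a b e : ℕ) :
    r * (a * p + b * q) + e ≡ n [MOD p * q] ↔
      a + α * e ≡ x₀ [MOD q] ∧ b ≡ y₀ + e [MOD p] := by
  have hiff : r * (a * p + b * q) + e ≡ n [MOD p * q] ↔
      r * (a * p + b * q) + e ≡ r * (x₀ * p + y₀ * q) [MOD p * q] :=
    ⟨fun h => h.trans hn, fun h => h.trans hn.symm⟩
  rw [hiff, ← Nat.modEq_and_modEq_iff_modEq_mul hpq, and_comm]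
  simp only [← ZMod.natCast_eq_natCast_iff] at hα hr ⊢
  push_cast at hα hr ⊢
  simp only [ZMod.natCast_self, mul_zero, add_zero, zero_add]
  refine and_congr ⟨fun h => ?_, fun h => ?_⟩ ⟨fun h => ?_, fun h => ?_⟩
  · linear_combination (α : ZMod q) * h - (a - x₀ : ZMod q) * hα
  · linear_combination (r * p : ZMod q) * h - (e : ZMod q) * hα
  · linear_combination (-1 : ZMod p) * h + (b - y₀ : ZMod p) * hr
  · linear_combination (-1 : ZMod p) * h + (b - y₀ : ZMod p) * hr

theorem coeff_cyclotomic_eq_sub {p q r ρ σ α β δ n : ℕ}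
    (hp : p.Prime) (hq : q.Prime) (hr : r.Prime) (hpq : p < q) (hqr : q < r)
    (hδ : p = β + 1 + δ) (hσp : σ < p) (hβσ : β < σ) (hσβ : p ≤ σ + β) (hqβ : q ≡ β [MOD p])
    (hρ : ρ * p + σ * q = p * q + 1) (hαq : α * p < q)
    (hδq : δ * q < β * q + δ * (α * p)) (hδρ : δ * α + 1 ≤ ρ) (hρq : ρ + α * β ≤ q)
    (hα : r * p * α ≡ 1 [MOD q]) (hrq : r * q + 1 ≡ 0 [MOD p])
    (hn : n ≡ r * ((ρ + α * β - 1) * p + (σ - β) * q) [MOD p * q])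
    (hT : ∀ k e, e < p + q → (r * k + e ≤ n ↔ k + p ≤ β * q)) :
    (cyclotomic (p * q * r) ℤ).coeff n = (p : ℤ) - β := by
  have hcop : p.Coprime q := (Nat.coprime_primes hp hq).2 hpq.ne
  have hmod := mul_add_modEq_iff hcop hα hrq hn
  have hρq' : ρ ≤ q := by omega
  have hbase : ∀ a ∈ Ico ρ q, ∀ b ∈ Ico σ p, p * q ≤ a * p + b * q := fun a ha b hb => by
    rw [mem_Ico] at ha hb
    have := Nat.mul_le_mul_right p ha.1
    have := Nat.mul_le_mul_right q hb.1
    omega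
  have hmod' : ∀ a ∈ Ico ρ q, ∀ b ∈ Ico σ p, ∀ e,
      (r * (a * p + b * q - p * q) + e ≡ n [MOD p * q] ↔
        a + α * e ≡ ρ + α * β - 1 [MOD q] ∧ b ≡ σ - β + e [MOD p]) := fun a ha b hb e => by
    rw [← hmod]
    obtain ⟨c, hc⟩ := Nat.exists_eq_add_of_le (hbase a ha b hb)
    have h1 : r * (p * q + c) + e = r * c + e + p * q * r := by ring
    rw [hc, Nat.add_sub_cancel_left, h1]
    simp [Nat.ModEq]
  have hα0 : ∀ {i a₀ a : ℕ}, a₀ + α * i = ρ + α * β - 1 → a₀ < q → a < q →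
      (a + α * i ≡ ρ + α * β - 1 [MOD q] ↔ a = a₀) := fun h ha₀ ha => by
    rw [← h]
    exact ⟨fun h => Nat.ModEq.eq_of_lt_of_lt (Nat.ModEq.add_right_cancel' _ h) ha ha₀,
      fun h => by rw [h]⟩
  have hb0 : ∀ {b y : ℕ}, b < p → (b ≡ y [MOD p] ↔ b = y % p) := fun hb => by
    rw [Nat.ModEq, Nat.mod_eq_of_lt hb]
  have hαshift : ∀ a i : ℕ, a + α * (q + i) ≡ ρ + α * β - 1 [MOD q] ↔
      a + α * i ≡ ρ + α * β - 1 [MOD q] := fun a i => by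
    rw [mul_add, mul_comm α q, add_left_comm]
    simp [Nat.ModEq]
  have hbshift : ∀ b i : ℕ, b ≡ σ - β + (q + i) [MOD p] ↔ b ≡ σ + i [MOD p] := fun b i => by
    have h : σ - β + (q + i) ≡ σ + i [MOD p] := by
      have := (hqβ.add_left (σ - β)).add_right i
      rwa [Nat.sub_add_cancel hβσ.le, add_assoc] at this
    exact ⟨fun h' => h'.trans h, fun h' => h'.trans h.symm⟩
  have hmodsub : ∀ {y : ℕ}, p ≤ y → y < 2 * p → y % p = y - p := fun h1 h2 => by
    rw [Nat.mod_eq_sub_mod h1, Nat.mod_eq_of_lt (by omega)]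
  have hαpos : 0 < α := by
    rw [Nat.pos_iff_ne_zero]
    rintro rfl
    rw [mul_zero, Nat.modEq_iff_dvd' zero_le_one] at hα
    exact hq.one_lt.ne' (Nat.dvd_one.1 hα)
  have hx : ∀ i < p, ∃ a₀, a₀ + α * i = ρ + α * β - 1 ∧ a₀ < q ∧ (a₀ < ρ ↔ β ≤ i) ∧
      (a₀ * p + p : ℤ) = p * q + 1 - σ * q + (β - i) * (α * p) := by
    intro i hi
    have h1 : α * i ≤ α * (β + δ) := Nat.mul_le_mul_left α (by omega)
    rw [mul_add, mul_comm α δ] at h1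
    have h2 : ρ + α * β - 1 - α * i + α * i = ρ + α * β - 1 := by omega
    refine ⟨ρ + α * β - 1 - α * i, h2, by omega, ⟨fun h => ?_, fun h => ?_⟩, ?_⟩
    · by_contra! hlt
      have := Nat.mul_le_mul_left α (Nat.succ_le_of_lt hlt)
      rw [Nat.mul_succ] at this
      omega
    · have := Nat.mul_le_mul_left α h
      omega
    · have h3 : ρ + α * β - 1 - α * i + α * i + 1 = ρ + α * β := by omega
      zify at h3 hρ
      linear_combination (p : ℤ) * h3 + hρ
  have hA : ∀ i ∈ range p,
      (∑ a ∈ range ρ, ∑ b ∈ range σ, classSum (p * q) n (X ^ (r * (a * p + b * q) + i))) -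
        (∑ a ∈ range ρ, ∑ b ∈ range σ,
          classSum (p * q) n (X ^ (r * (a * p + b * q) + (q + i)))) =
      if p + β ≤ σ + i then 1 else 0 := by
    intro i hi
    rw [mem_range] at hi
    obtain ⟨a₀, ha, haq, haρ, hkey⟩ := hx i hi
    rw [sum_sum_classSum (a₀ := a₀) (b₀ := (σ - β + i) % p) fun a ha' b hb => by
        rw [mem_range] at ha' hb
        rw [hmod, hα0 ha haq (by omega), hb0 (by omega)],
      sum_sum_classSum (a₀ := a₀) (b₀ := (σ + i) % p) fun a ha' b hb => by
        rw [mem_range] at ha' hb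
        rw [hmod, hαshift, hbshift, hα0 ha haq (by omega), hb0 (by omega)]]
    have hfst : (a₀ ∈ range ρ ∧ (σ - β + i) % p ∈ range σ ∧
        r * (a₀ * p + (σ - β + i) % p * q) + i ≤ n) ↔ p + β ≤ σ + i := by
      rw [hT _ _ (by omega), mem_range, mem_range, haρ]
      constructor
      · rintro ⟨h1, h2, -⟩
        by_contra! h3
        rw [Nat.mod_eq_of_lt (by omega)] at h2
        omega
      · intro h
        obtain ⟨c, hc⟩ := Nat.exists_eq_add_of_le h
        have hmod₁ : (σ - β + i) % p = c := by
          rw [hmodsub (by omega) (by omega)]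
          omega
        rw [hmod₁]
        refine ⟨by omega, by omega, ?_⟩
        zify at hc hδ hi hδq hαq ⊢
        nlinarith [mul_nonneg (show (0 : ℤ) ≤ δ - (i - β) by linarith)
          (sub_nonneg.2 hαq.le)]
    have hsnd : ¬ (a₀ ∈ range ρ ∧ (σ + i) % p ∈ range σ ∧
        r * (a₀ * p + (σ + i) % p * q) + (q + i) ≤ n) := by
      rw [hT _ _ (by omega), mem_range, mem_range, haρ]
      rintro ⟨h1, h2, h3⟩
      obtain ⟨c, hc⟩ := Nat.exists_eq_add_of_le (show p ≤ σ + i by omega)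
      have hmod₁ : (σ + i) % p = c := by
        rw [hmodsub (by omega) (by omega)]
        omega
      rw [hmod₁] at h3
      zify at hc h1 hαq h3
      nlinarith [mul_nonneg (sub_nonneg.2 h1) (sub_nonneg.2 hαq.le)]
    simp only [hfst, if_neg hsnd, sub_zero]
  have hB : ∀ i ∈ range p,
      (∑ a ∈ Ico ρ q, ∑ b ∈ Ico σ p, classSum (p * q) n (X ^ (r * (a * p + b * q - p * q) + i))) -
        (∑ a ∈ Ico ρ q, ∑ b ∈ Ico σ p,
          classSum (p * q) n (X ^ (r * (a * p + b * q - p * q) + (q + i)))) =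
      -if σ + i < p then 1 else 0 := by
    intro i hi
    rw [mem_range] at hi
    obtain ⟨a₀, ha, haq, haρ, hkey⟩ := hx i hi
    rw [sum_sum_classSum (k := fun a b => a * p + b * q - p * q)
        (a₀ := a₀) (b₀ := (σ - β + i) % p) fun a ha' b hb => by
        rw [hmod' a ha' b hb]
        rw [mem_Ico] at ha' hb
        rw [hα0 ha haq (by omega), hb0 (by omega)],
      sum_sum_classSum (k := fun a b => a * p + b * q - p * q)
        (a₀ := a₀) (b₀ := (σ + i) % p) fun a ha' b hb => by
        rw [hmod' a ha' b hb]
        rw [mem_Ico] at ha' hb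
        rw [hαshift, hbshift, hα0 ha haq (by omega), hb0 (by omega)]]
    have hfst : ¬ (a₀ ∈ Ico ρ q ∧ (σ - β + i) % p ∈ Ico σ p ∧
        r * (a₀ * p + (σ - β + i) % p * q - p * q) + i ≤ n) := by
      rw [mem_Ico, mem_Ico, ← not_lt, haρ]
      rintro ⟨⟨h1, -⟩, ⟨h2, -⟩, -⟩
      rw [Nat.mod_eq_of_lt (by omega)] at h2
      omega
    have hsnd : (a₀ ∈ Ico ρ q ∧ (σ + i) % p ∈ Ico σ p ∧
        r * (a₀ * p + (σ + i) % p * q - p * q) + (q + i) ≤ n) ↔ σ + i < p := by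
      rw [hT _ _ (by omega), mem_Ico, mem_Ico, ← not_lt, haρ]
      constructor
      · rintro ⟨-, ⟨h2, -⟩, -⟩
        by_contra! h3
        rw [hmodsub h3 (by omega)] at h2
        omega
      · intro h
        rw [Nat.mod_eq_of_lt h]
        have hle := hbase a₀ (mem_Ico.2 ⟨not_lt.1 (by rw [haρ]; omega), haq⟩) (σ + i)
          (mem_Ico.2 ⟨by omega, h⟩)
        have hiβ : i + 1 ≤ β := by omega
        refine ⟨⟨by omega, haq⟩, ⟨by omega, h⟩, ?_⟩
        zify [hle] at hiβ hαq ⊢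
        nlinarith [mul_nonneg (sub_nonneg.2 hiβ) (sub_nonneg.2 hαq.le)]
    simp only [hsnd, if_neg hfst, zero_sub]
  have hcard₁ : (range p).filter (fun i => p + β ≤ σ + i) = Ico (p + β - σ) p := by
    ext i
    simp only [mem_filter, mem_range, mem_Ico]
    omega
  have hcard₂ : (range p).filter (fun i => σ + i < p) = range (p - σ) := by
    ext i
    simp only [mem_filter, mem_range]
    omega
  rw [← classSum_mul_one_sub_X_pow (Nat.mul_pos hp.pos hq.pos) n,
    cyclotomic_three_primes_mul hp hq hr hpq.ne (hpq.trans hqr).ne hqr.ne,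
    cyclotomic_mul_prime_eq hp hq hpq.ne hρq' hσp.le hρ, map_sub, sub_mul, map_sub,
    classSum_expand_mul, classSum_expand_mul, sum_congr rfl hA, sum_congr rfl hB,
    sum_neg_distrib, sum_boole, sum_boole, hcard₁, hcard₂, Nat.card_Ico, card_range]
  omega

theorem exists_slope {p q ρ σ β δ : ℕ} (hδ : p = β + 1 + δ) (hβδ : β ≤ δ) (hσp : σ < p)
    (hβσ : β < σ) (hσβ : p ≤ σ + β) (hσ : σ ≤ 2 * β) (hpq : p * p < q)
    (hρ : ρ * p + σ * q = p * q + 1) :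
    ∃ α, 0 < α ∧ α * p < q ∧ δ * q < β * q + δ * (α * p) ∧ δ * α + 1 ≤ ρ ∧ ρ + α * β ≤ q := by
  have hp : 0 < p := by omega
  have hm : 0 < δ * p := Nat.mul_pos (by omega) hp
  obtain ⟨d, rfl⟩ := Nat.exists_eq_add_of_le hβδ
  have hle := Nat.div_mul_le_self (d * q) ((β + d) * p)
  have hlt := (Nat.div_lt_iff_lt_mul hm).1 (Nat.lt_succ_self (d * q / ((β + d) * p)))
  set c := d * q / ((β + d) * p)
  have hup : (β + d) * ((c + 1) * p) + p ≤ ρ * p := by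
    have h1 : (β + d + 1) * p ≤ p * p := Nat.mul_le_mul_right p (by omega)
    have h2 : (d + 1 + σ) * q ≤ p * q := Nat.mul_le_mul_right q (by omega)
    linarith
  have hρβ : ρ * p ≤ β * q + 1 := by
    have := Nat.mul_le_mul_right q hσβ
    linarith
  have hβ : (c + 1) * p * β ≤ (β + d) * ((c + 1) * p) := by
    rw [mul_comm]
    exact Nat.mul_le_mul_right _ hβδ
  refine ⟨c + 1, c.succ_pos, ?_, by linarith, ?_, ?_⟩
  · have hβq : β * q ≤ (β + d) * q := Nat.mul_le_mul_right q hβδ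
    refine Nat.lt_of_mul_lt_mul_left (a := β + d) ?_
    omega
  · refine Nat.le_of_mul_le_mul_right ?_ hp
    linarith
  · refine Nat.le_of_mul_le_mul_right ?_ hp
    have : (2 * β + 1) * q ≤ p * q := Nat.mul_le_mul_right q (by omega)
    linarith [show 2 ≤ p by omega]

theorem exists_prime_mul_modEq {p q m : ℕ} (hp : p.Prime) (hq : q.Prime) (hpq : p ≠ q)
    (hm : m.Coprime q) (L : ℕ) :
    ∃ r > L, r.Prime ∧ r * m ≡ 1 [MOD q] ∧ r * q + 1 ≡ 0 [MOD p] := by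
  have := Fact.mk hp
  have := Fact.mk hq
  have hcop : p.Coprime q := (Nat.coprime_primes hp hq).2 hpq
  have hqp : (q : ZMod p) ≠ 0 := by
    rw [Ne, ZMod.natCast_eq_zero_iff, ← hp.coprime_iff_not_dvd]
    exact hcop
  have hmq : (m : ZMod q) ≠ 0 := by
    rw [Ne, ZMod.natCast_eq_zero_iff, ← hq.coprime_iff_not_dvd]
    exact hm.symm
  obtain ⟨c, hcp, hcq⟩ :=
    Nat.chineseRemainder hcop (-(q : ZMod p)⁻¹).val (m : ZMod q)⁻¹.val
  rw [← ZMod.natCast_eq_natCast_iff, ZMod.natCast_zmod_val] at hcp hcq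
  have hcunit : c.Coprime (p * q) := by
    refine Nat.Coprime.mul_right ?_ ?_
    · rw [← ZMod.isUnit_iff_coprime, hcp]
      exact (neg_ne_zero.2 (inv_ne_zero hqp)).isUnit
    · rw [← ZMod.isUnit_iff_coprime, hcq]
      exact (inv_ne_zero hmq).isUnit
  obtain ⟨r, hrL, hr, hrc⟩ :=
    Nat.forall_exists_prime_gt_and_modEq L (Nat.mul_pos hp.pos hq.pos).ne' hcunit
  have hrp : (r : ZMod p) = c :=
    (ZMod.natCast_eq_natCast_iff _ _ _).2 (hrc.of_dvd (dvd_mul_right p q))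
  have hrq : (r : ZMod q) = c :=
    (ZMod.natCast_eq_natCast_iff _ _ _).2 (hrc.of_dvd (dvd_mul_left q p))
  refine ⟨r, hrL, hr, ?_, ?_⟩
  · rw [← ZMod.natCast_eq_natCast_iff]
    push_cast
    rw [hrq, hcq, inv_mul_cancel₀ hmq]
  · rw [← ZMod.natCast_eq_natCast_iff]
    push_cast
    rw [hrp, hcp, neg_mul, inv_mul_cancel₀ hqp, neg_add_cancel]

theorem exists_modEq_and_le_iff {N r s : ℕ} (hN : 0 < N) (hr : 2 * N ≤ r) (hs : s ≤ N + 1)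
    (M T : ℕ) :
    ∃ n, n ≡ M [MOD N] ∧ ∀ k e, e < s → (r * k + e ≤ n ↔ k ≤ T) := by
  have hlt := Nat.mod_lt (M + (N - 1) * (r * T)) hN
  refine ⟨r * T + N + (M + (N - 1) * (r * T)) % N, ?_, fun k e he => ⟨fun h => ?_, fun h => ?_⟩⟩
  · have h1 : r * T + N + (M + (N - 1) * (r * T)) = M + N * (r * T + 1) := by
      obtain ⟨N, rfl⟩ := Nat.exists_eq_add_of_lt hN
      simp only [zero_add, Nat.add_sub_cancel]
      ring
    have h2 := (Nat.mod_modEq (M + (N - 1) * (r * T)) N).add_left (r * T + N)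
    rw [h1] at h2
    exact h2.trans (by simp [Nat.ModEq])
  · by_contra! hk
    have := Nat.mul_le_mul_left r (Nat.succ_le_of_lt hk)
    rw [Nat.mul_succ] at this
    omega
  · have := Nat.mul_le_mul_left r h
    omega

theorem stmt_2 (p : ℕ) (hp : p.Prime) :
    ∃ Q : ℕ, ∀ β ∈ Bplus p, ∀ q : ℕ, q.Prime → Q < q → q ≡ β [MOD p] →
      ∃ r : ℕ, r.Prime ∧ q < r ∧ ∃ n : ℕ,
        (Polynomial.cyclotomic (p * q * r) ℤ).coeff n = (p : ℤ) - (β : ℤ) := by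
  refine ⟨p * p, fun β hβ q hq hQ hqβ => ?_⟩
  have := Fact.mk hp
  simp only [Bplus, mem_filter, mem_Icc] at hβ
  obtain ⟨⟨hβ1, -⟩, hβp, hσβ, hσ⟩ := hβ
  have hσp : modInv p β < p := ZMod.val_lt _
  have hβσ1 : ((modInv p β : ℕ) : ZMod p) * β = 1 := by
    rw [modInv, ZMod.natCast_zmod_val]
    refine inv_mul_cancel₀ ?_
    rw [Ne, ZMod.natCast_eq_zero_iff]
    exact Nat.not_dvd_of_pos_of_lt hβ1 (by omega)
  generalize modInv p β = σ at *
  rw [add_comm] at hσβ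
  obtain ⟨δ, hδ⟩ := Nat.exists_eq_add_of_le (show β + 1 ≤ p by omega)
  have hpq : p < q := (Nat.le_mul_self p).trans_lt hQ
  obtain ⟨ρ, hρ⟩ : ∃ ρ, ρ * p + σ * q = p * q + 1 := by
    have hle : σ * q ≤ p * q + 1 := (Nat.mul_le_mul_right q hσp.le).trans (Nat.le_succ _)
    have hdvd : p ∣ p * q + 1 - σ * q := by
      rw [← Nat.modEq_iff_dvd' hle, ← ZMod.natCast_eq_natCast_iff]
      rw [← ZMod.natCast_eq_natCast_iff] at hqβ
      push_cast
      rw [hqβ, hβσ1, ZMod.natCast_self, zero_mul, zero_add]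
    obtain ⟨ρ, hρ⟩ := hdvd
    exact ⟨ρ, by rw [mul_comm ρ, ← hρ, Nat.sub_add_cancel hle]⟩
  obtain ⟨α, hα0, hαq, hδq, hδρ, hρq⟩ :=
    exists_slope hδ (by omega) hσp (by omega) hσβ hσ hQ hρ
  have hT : p ≤ β * q := hpq.le.trans (Nat.le_mul_of_pos_left q hβ1)
  have hαcop : (p * α).Coprime q := Nat.Coprime.mul_left
    ((Nat.coprime_primes hp hq).2 hpq.ne)
    (Nat.coprime_of_lt_prime hα0.ne' ((Nat.le_mul_of_pos_right α hp.pos).trans_lt hαq) hq).symm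
  obtain ⟨r, hrL, hr, hα, hrq⟩ := exists_prime_mul_modEq hp hq hpq.ne hαcop (2 * (p * q))
  have hqr : q < r := by
    have := Nat.le_mul_of_pos_left q hp.pos
    omega
  obtain ⟨n, hn, hT'⟩ := exists_modEq_and_le_iff (s := p + q) (Nat.mul_pos hp.pos hq.pos) hrL.le
    (Nat.add_le_mul hp.two_le hq.two_le |>.trans (Nat.le_succ _))
    (r * ((ρ + α * β - 1) * p + (σ - β) * q)) (β * q - p)
  refine ⟨r, hr, hqr, n, coeff_cyclotomic_eq_sub hp hq hr hpq hqr hδ hσp (by omega) hσβ hqβ hρ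
    hαq hδq hδρ hρq (by rwa [mul_assoc]) hrq hn fun k e he => ?_⟩
  rw [hT' k e he]
  omega
end

section
/- For any prime number p, the cardinality of 𝓑₋(p) satisfies |#𝓑₋(p) − p/48| ≤ 12 · p^{3/4} · log p, where log denotes the natural logarithm. -/
section KloostermanSums

open Finset ZMod

variable {p : ℕ} [Fact p.Prime]

lemma four_mul_le_norm_stdAddChar_sub_one (a : ZMod p) :
    4 * (a.valMinAbs.natAbs : ℝ) / p ≤ ‖stdAddChar a - 1‖ := by
  have hp : (0 : ℝ) < p := by exact_mod_cast (Fact.out : p.Prime).pos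
  have key : ‖stdAddChar a - 1‖ = 2 * |Real.sin (Real.pi * a.valMinAbs / p)| := by
    conv_lhs => rw [← coe_valMinAbs a, stdAddChar_coe]
    rw [show 2 * (Real.pi : ℂ) * Complex.I * (a.valMinAbs : ℂ) / (p : ℂ) =
      Complex.I * ((2 * (Real.pi * a.valMinAbs / p) : ℝ) : ℂ) by push_cast; ring,
      Complex.norm_exp_I_mul_ofReal_sub_one]
    simp
  have hd : (a.valMinAbs.natAbs : ℝ) = |(a.valMinAbs : ℝ)| := by
    rw [← Int.cast_abs, Int.abs_eq_natAbs]; simp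
  have hle : 2 * |(a.valMinAbs : ℝ)| ≤ p := by
    rw [← hd]
    have := natAbs_valMinAbs_le a
    exact_mod_cast (show 2 * a.valMinAbs.natAbs ≤ p by omega)
  have habs : |Real.pi * a.valMinAbs / p| = Real.pi * |(a.valMinAbs : ℝ)| / p := by
    rw [abs_div, abs_mul, abs_of_pos Real.pi_pos, abs_of_pos hp]
  have hsin := Real.mul_abs_le_abs_sin (x := Real.pi * a.valMinAbs / p) (by
    rw [habs, div_le_div_iff₀ hp two_pos]
    nlinarith [Real.pi_pos])
  rw [key, hd]
  rw [habs] at hsin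
  calc _ = 2 * (2 / Real.pi * (Real.pi * |(a.valMinAbs : ℝ)| / p)) := by
        field_simp; ring
    _ ≤ _ := by gcongr

lemma stdAddChar_eq_one_iff {a : ZMod p} : stdAddChar a = 1 ↔ a = 0 := by
  rw [← AddChar.map_zero_eq_one (stdAddChar (N := p))]
  exact injective_stdAddChar.eq_iff

lemma natAbs_valMinAbs_pos {a : ZMod p} (ha : a ≠ 0) : 0 < (a.valMinAbs.natAbs : ℝ) := by
  have : a.valMinAbs ≠ 0 := by simpa using ha
  exact_mod_cast Int.natAbs_pos.mpr this

lemma inv_norm_stdAddChar_sub_one_le {a : ZMod p} (ha : a ≠ 0) :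
    ‖stdAddChar a - 1‖⁻¹ ≤ p / 4 * (a.valMinAbs.natAbs : ℝ)⁻¹ := by
  have hp : (0 : ℝ) < p := by exact_mod_cast (Fact.out : p.Prime).pos
  have hd := natAbs_valMinAbs_pos ha
  calc _ ≤ (4 * (a.valMinAbs.natAbs : ℝ) / p)⁻¹ := by
        gcongr; exact four_mul_le_norm_stdAddChar_sub_one a
    _ = _ := by field_simp

lemma sum_Ico_stdAddChar {a : ZMod p} (ha : a ≠ 0) {m n : ℕ} (hmn : m ≤ n) :
    ∑ x ∈ Ico m n, stdAddChar (a * (x : ZMod p)) =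
      (stdAddChar (a * (n : ZMod p)) - stdAddChar (a * (m : ZMod p))) * (stdAddChar a - 1)⁻¹ := by
  have h (x : ℕ) : stdAddChar (a * (x : ZMod p)) = stdAddChar a ^ x := by
    rw [mul_comm, ← nsmul_eq_mul, AddChar.map_nsmul_eq_pow]
  simp only [h]
  rw [geom_sum_Ico (by rwa [Ne, stdAddChar_eq_one_iff]) hmn, div_eq_mul_inv]

lemma norm_sum_Ico_stdAddChar_le {a : ZMod p} (ha : a ≠ 0) {m n : ℕ} (hmn : m ≤ n) :
    ‖∑ x ∈ Ico m n, stdAddChar (a * (x : ZMod p))‖ ≤ p / 2 * (a.valMinAbs.natAbs : ℝ)⁻¹ := by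
  rw [sum_Ico_stdAddChar ha hmn, norm_mul, norm_inv]
  calc _ ≤ (1 + 1) * (p / 4 * (a.valMinAbs.natAbs : ℝ)⁻¹) := by
        gcongr
        · exact (norm_sub_le _ _).trans (by simp [AddChar.norm_apply])
        · exact inv_norm_stdAddChar_sub_one_le ha
    _ = _ := by ring

lemma sum_ne_zero_natAbs_valMinAbs_le {g : ℕ → ℝ} (hg : ∀ n, 0 ≤ g n) :
    ∑ a : ZMod p with a ≠ 0, g a.valMinAbs.natAbs ≤ 2 * ∑ n ∈ Ico 1 p, g n := by
  have hp := (Fact.out : p.Prime).pos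
  calc ∑ a : ZMod p with a ≠ 0, g a.valMinAbs.natAbs
      ≤ ∑ a : ZMod p with a ≠ 0, (g a.val + g (p - a.val)) := by
        gcongr with a
        rw [valMinAbs_natAbs_eq_min]
        rcases min_choice a.val (p - a.val) with h | h <;> rw [h]
        · linarith [hg (p - a.val)]
        · linarith [hg a.val]
    _ = ∑ n ∈ Ico 1 p, (g n + g (p - n)) := by
        refine sum_nbij' (fun a ↦ a.val) (fun n ↦ (n : ZMod p)) ?_ ?_ ?_ ?_ ?_
        · intro a ha
          have : a.val ≠ 0 := by simpa using ha
          simp only [mem_Ico]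
          exact ⟨by omega, a.val_lt⟩
        · intro n hn
          rw [mem_Ico] at hn
          simp only [mem_filter, mem_univ, true_and]
          intro h
          have := congrArg ZMod.val h
          rw [val_natCast_of_lt hn.2, val_zero] at this
          omega
        · intro a _; simp
        · intro n hn
          exact val_natCast_of_lt (mem_Ico.mp hn).2
        · intro a _; rfl
    _ = _ := by
        have := sum_Ico_reflect g 1 (m := p) (n := p) (by omega)
        rw [sum_add_distrib, this]
        simp [two_mul]

/-- The Kloosterman sum `∑ e((a x⁻¹ + c x) / p)` over the units `x` modulo `p`. -/
noncomputable def kloostermanSum (a c : ZMod p) : ℂ :=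
  ∑ x : (ZMod p)ˣ, stdAddChar (a * (x : ZMod p)⁻¹ + c * (x : ZMod p))

lemma kloostermanSum_unit_mul (t : (ZMod p)ˣ) (a c : ZMod p) :
    kloostermanSum ((t : ZMod p) * a) c = kloostermanSum a (c * t) := by
  unfold kloostermanSum
  rw [← Equiv.sum_comp (Equiv.mulLeft t)]
  refine sum_congr rfl fun x _ ↦ ?_
  congr 1
  have ht := t.ne_zero
  have hx := x.ne_zero
  simp only [Equiv.coe_mulLeft, Units.val_mul]
  field_simp

lemma sum_stdAddChar_mul (b : ZMod p) :
    ∑ x : ZMod p, stdAddChar (x * b) = if b = 0 then (p : ℂ) else 0 := by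
  have := AddChar.sum_mulShift b (isPrimitive_stdAddChar p)
  rw [this]; simp

/-- Parseval's identity for exponential sums in two variables. -/
lemma sum_sum_norm_sq_eq {ι : Type*} [Fintype ι] (u v : ι → ZMod p) :
    ∑ a : ZMod p, ∑ c : ZMod p, ‖∑ i, stdAddChar (a * u i + c * v i)‖ ^ 2 =
      (p : ℝ) ^ 2 * ∑ i, (#{j | u i = u j ∧ v i = v j} : ℝ) := by
  have h (a c : ZMod p) : ((‖∑ i, stdAddChar (a * u i + c * v i)‖ ^ 2 : ℝ) : ℂ) =
      ∑ i, ∑ j, stdAddChar (a * (u i - u j)) * stdAddChar (c * (v i - v j)) := by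
    push_cast
    rw [← Complex.mul_conj', map_sum, sum_mul_sum]
    refine sum_congr rfl fun i _ ↦ sum_congr rfl fun j _ ↦ ?_
    rw [← AddChar.map_neg_eq_conj, ← AddChar.map_add_eq_mul, ← AddChar.map_add_eq_mul]
    congr 1
    ring
  apply Complex.ofReal_injective
  rw [Complex.ofReal_sum]
  simp only [Complex.ofReal_sum, h]
  calc _ = ∑ i, ∑ j, (∑ a : ZMod p, stdAddChar (a * (u i - u j))) *
        ∑ c : ZMod p, stdAddChar (c * (v i - v j)) := by
        simp_rw [sum_mul_sum]
        rw [sum_congr rfl fun a _ ↦ sum_comm, sum_comm]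
        refine sum_congr rfl fun i _ ↦ ?_
        rw [sum_congr rfl fun a _ ↦ sum_comm, sum_comm]
    _ = _ := by
        push_cast
        rw [mul_sum]
        refine sum_congr rfl fun i _ ↦ ?_
        simp only [sum_stdAddChar_mul, sub_eq_zero]
        rw [card_eq_sum_ones, sum_filter]
        push_cast
        rw [mul_sum]
        refine sum_congr rfl fun j _ ↦ ?_
        by_cases h1 : u i = u j <;> by_cases h2 : v i = v j <;> simp [h1, h2, sq]

lemma card_inv_add_inv_eq_and_add_eq_le (i : (ZMod p)ˣ × (ZMod p)ˣ) :
    #{j : (ZMod p)ˣ × (ZMod p)ˣ |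
      (i.1 : ZMod p)⁻¹ + (i.2 : ZMod p)⁻¹ = (j.1 : ZMod p)⁻¹ + (j.2 : ZMod p)⁻¹
        ∧ (i.1 : ZMod p) + i.2 = j.1 + j.2} ≤ 2 + if i.2 = -i.1 then p - 1 else 0 := by
  obtain ⟨x, y⟩ := i
  split_ifs with h
  · refine le_add_left ?_
    calc _ ≤ #(univ.image fun z : (ZMod p)ˣ ↦ (z, -z)) := by
          refine card_le_card fun j hj ↦ ?_
          obtain ⟨z, w⟩ := j
          simp only [mem_filter, mem_univ, true_and] at hj
          simp only at h
          simp only [mem_image, mem_univ, true_and, Prod.mk.injEq]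
          refine ⟨z, rfl, ?_⟩
          ext
          have := hj.2
          rw [h] at this
          push_cast at this ⊢
          linear_combination this
      _ ≤ Fintype.card (ZMod p)ˣ := card_image_le
      _ = _ := card_units p
  · calc _ ≤ #({(x, y), (y, x)} : Finset ((ZMod p)ˣ × (ZMod p)ˣ)) := by
          refine card_le_card fun j hj ↦ ?_
          obtain ⟨z, w⟩ := j
          simp only [mem_filter, mem_univ, true_and] at hj
          obtain ⟨h1, h2⟩ := hj
          have hs : (x : ZMod p) + y ≠ 0 := by
            intro h0
            apply h
            ext
            push_cast
            linear_combination h0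
          have hx := x.ne_zero
          have hy := y.ne_zero
          have hz := z.ne_zero
          have hw := w.ne_zero
          field_simp at h1
          have hprod : (z : ZMod p) * w = x * y := by
            apply mul_left_cancel₀ hs
            linear_combination h1 - (x : ZMod p) * y * h2
          have : ((z : ZMod p) - x) * (z - y) = 0 := by
            linear_combination (-(z : ZMod p)) * h2 - hprod
          simp only [mem_insert, mem_singleton, Prod.mk.injEq]
          rcases mul_eq_zero.mp this with h3 | h3
          · left
            refine ⟨Units.ext (by linear_combination h3), Units.ext ?_⟩
            linear_combination - h2 - h3
          · right
            refine ⟨Units.ext (by linear_combination h3), Units.ext ?_⟩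
            linear_combination - h2 - h3
      _ ≤ 2 := card_le_two
      _ ≤ _ := by omega

lemma sum_sum_norm_kloostermanSum_pow_four_le :
    ∑ a : ZMod p, ∑ c : ZMod p, ‖kloostermanSum a c‖ ^ 4 ≤ 3 * (p : ℝ) ^ 2 * (p - 1) ^ 2 := by
  have hsq (a c : ZMod p) : ‖kloostermanSum a c‖ ^ 4 =
      ‖∑ i : (ZMod p)ˣ × (ZMod p)ˣ, stdAddChar
        (a * ((i.1 : ZMod p)⁻¹ + (i.2 : ZMod p)⁻¹) +
          c * ((i.1 : ZMod p) + (i.2 : ZMod p)))‖ ^ 2 := by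
    rw [show 4 = 2 * 2 from rfl, pow_mul, ← norm_pow]
    congr 2
    rw [sq, kloostermanSum, sum_mul_sum, Fintype.sum_prod_type]
    refine sum_congr rfl fun x _ ↦ sum_congr rfl fun y _ ↦ ?_
    rw [← AddChar.map_add_eq_mul]
    congr 1
    ring
  simp only [hsq]
  rw [sum_sum_norm_sq_eq]
  have hp := (Fact.out : p.Prime).one_le
  have hcard : ∑ i : (ZMod p)ˣ × (ZMod p)ˣ, #{j : (ZMod p)ˣ × (ZMod p)ˣ |
      (i.1 : ZMod p)⁻¹ + (i.2 : ZMod p)⁻¹ = (j.1 : ZMod p)⁻¹ + (j.2 : ZMod p)⁻¹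
        ∧ (i.1 : ZMod p) + i.2 = j.1 + j.2} ≤ 3 * (p - 1) ^ 2 := by
    refine (sum_le_sum fun i _ ↦ card_inv_add_inv_eq_and_add_eq_le i).trans ?_
    rw [sum_add_distrib, Fintype.sum_prod_type, Fintype.sum_prod_type]
    simp only [sum_const, card_univ, card_units, sum_ite_eq', mem_univ, if_true, smul_eq_mul]
    apply le_of_eq
    ring
  have hcard' : ∑ i : (ZMod p)ˣ × (ZMod p)ˣ, (#{j : (ZMod p)ˣ × (ZMod p)ˣ |
      (i.1 : ZMod p)⁻¹ + (i.2 : ZMod p)⁻¹ = (j.1 : ZMod p)⁻¹ + (j.2 : ZMod p)⁻¹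
        ∧ (i.1 : ZMod p) + i.2 = j.1 + j.2} : ℝ) ≤ 3 * ((p : ℝ) - 1) ^ 2 := by
    have : (((3 * (p - 1) ^ 2 : ℕ)) : ℝ) = 3 * ((p : ℝ) - 1) ^ 2 := by
      push_cast [Nat.cast_sub hp]; ring
    rw [← this]
    exact_mod_cast hcard
  calc _ ≤ (p : ℝ) ^ 2 * (3 * ((p : ℝ) - 1) ^ 2) := by gcongr
    _ = _ := by ring

lemma sum_norm_kloostermanSum_pow_four_le {a : ZMod p} (ha : a ≠ 0) :
    ∑ c : ZMod p, ‖kloostermanSum a c‖ ^ 4 ≤ 3 * (p : ℝ) ^ 3 := by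
  have hp : (1 : ℝ) < p := by exact_mod_cast (Fact.out : p.Prime).one_lt
  have hinv (t : (ZMod p)ˣ) : ∑ c : ZMod p, ‖kloostermanSum ((t : ZMod p) * a) c‖ ^ 4 =
      ∑ c : ZMod p, ‖kloostermanSum a c‖ ^ 4 := by
    simp only [kloostermanSum_unit_mul]
    exact Equiv.sum_comp (Units.mulRight t) fun c ↦ ‖kloostermanSum a c‖ ^ 4
  have hunits : ((p : ℝ) - 1) * ∑ c : ZMod p, ‖kloostermanSum a c‖ ^ 4 ≤
      ∑ b : ZMod p, ∑ c : ZMod p, ‖kloostermanSum b c‖ ^ 4 := by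
    calc _ = ∑ t : (ZMod p)ˣ, ∑ c : ZMod p, ‖kloostermanSum ((t : ZMod p) * a) c‖ ^ 4 := by
          simp only [hinv, sum_const, card_univ, card_units, nsmul_eq_mul]
          rw [Nat.cast_sub (Fact.out : p.Prime).one_le, Nat.cast_one]
      _ = ∑ b ∈ univ.image fun t : (ZMod p)ˣ ↦ (t : ZMod p) * a,
          ∑ c : ZMod p, ‖kloostermanSum b c‖ ^ 4 := by
          rw [sum_image]
          intro s _ t _ h
          exact Units.ext (mul_right_cancel₀ ha h)
      _ ≤ _ := sum_le_sum_of_subset_of_nonneg (subset_univ _) fun _ _ _ ↦ by positivity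
  have := hunits.trans sum_sum_norm_kloostermanSum_pow_four_le
  have h2 : ∑ c : ZMod p, ‖kloostermanSum a c‖ ^ 4 ≤ 3 * (p : ℝ) ^ 2 * (p - 1) := by
    refine le_of_mul_le_mul_left (this.trans_eq ?_) (sub_pos.mpr hp)
    ring
  nlinarith [sq_nonneg (p : ℝ)]

lemma sum_Ico_inv_le_one_add_log (n : ℕ) :
    ∑ k ∈ Ico 1 n, (k : ℝ)⁻¹ ≤ 1 + Real.log n := by
  have h := harmonic_le_one_add_log n
  rw [harmonic_eq_sum_Icc] at h
  push_cast at h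
  refine le_trans (sum_le_sum_of_subset_of_nonneg (fun k hk ↦ ?_) fun _ _ _ ↦ by positivity) h
  simp only [mem_Ico, mem_Icc] at hk ⊢
  omega

lemma rpow_neg_four_thirds_le {n : ℕ} (hn : 0 < n) :
    ((n + 1 : ℕ) : ℝ) ^ (-(4 / 3) : ℝ) ≤
      3 * ((n : ℝ) ^ (-(1 / 3) : ℝ) - ((n + 1 : ℕ) : ℝ) ^ (-(1 / 3) : ℝ)) := by
  have hpow (m : ℕ) (hm : 0 < m) : ∃ s : ℝ, 0 < s ∧ s ^ 3 = m ∧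
      (m : ℝ) ^ (-(1 / 3) : ℝ) = s⁻¹ ∧ (m : ℝ) ^ (-(4 / 3) : ℝ) = (s ^ 4)⁻¹ := by
    have hm' : (0 : ℝ) < m := by exact_mod_cast hm
    refine ⟨(m : ℝ) ^ (1 / 3 : ℝ), by positivity, ?_, ?_, ?_⟩
    · rw [← Real.rpow_natCast, ← Real.rpow_mul hm'.le]; norm_num
    · rw [Real.rpow_neg hm'.le]
    · rw [Real.rpow_neg hm'.le, ← Real.rpow_natCast, ← Real.rpow_mul hm'.le]; norm_num
  obtain ⟨s, hs, hs3, hs1, -⟩ := hpow n hn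
  obtain ⟨t, ht, ht3, ht1, ht4⟩ := hpow (n + 1) n.succ_pos
  rw [hs1, ht1, ht4]
  have hdiff : t ^ 3 - s ^ 3 = 1 := by rw [hs3, ht3]; push_cast; ring
  have hst : s ≤ t := by
    by_contra! h
    have := pow_lt_pow_left₀ h ht.le (n := 3) (by norm_num)
    linarith
  have h1 : 1 ≤ 3 * t ^ 2 * (t - s) := by
    nlinarith [mul_nonneg (mul_nonneg ht.le (sub_nonneg.mpr hst)) (sub_nonneg.mpr hst),
      mul_nonneg (mul_nonneg hs.le (sub_nonneg.mpr hst)) (sub_nonneg.mpr hst)]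
  rw [inv_sub_inv hs.ne' ht.ne', inv_eq_one_div, ← mul_div_assoc,
    div_le_div_iff₀ (by positivity) (by positivity)]
  calc 1 * (s * t) ≤ 1 * (t * t) := by gcongr
    _ ≤ (3 * t ^ 2 * (t - s)) * (t * t) := by gcongr
    _ = _ := by ring

lemma sum_Ico_rpow_neg_four_thirds_le (n : ℕ) :
    ∑ k ∈ Ico 1 n, (k : ℝ) ^ (-(4 / 3) : ℝ) ≤ 4 := by
  have h (n : ℕ) : ∑ k ∈ Ico 1 (n + 2), (k : ℝ) ^ (-(4 / 3) : ℝ) ≤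
      4 - 3 * ((n + 1 : ℕ) : ℝ) ^ (-(1 / 3) : ℝ) := by
    induction n with
    | zero => norm_num
    | succ n ih =>
      rw [sum_Ico_succ_top (by omega)]
      linarith [rpow_neg_four_thirds_le (n := n + 1) (by omega)]
  refine le_trans (sum_le_sum_of_subset_of_nonneg (t := Ico 1 (n + 2)) ?_ fun _ _ _ ↦ by positivity)
    ((h n).trans ?_)
  · exact Ico_subset_Ico_right (by omega)
  · have : (0 : ℝ) ≤ ((n + 1 : ℕ) : ℝ) ^ (-(1 / 3) : ℝ) := by positivity
    linarith

/-- Completion of an incomplete Kloosterman sum. -/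
lemma card_mul_sum_Ico_stdAddChar_inv {A B : ℕ} (hA : 1 ≤ A) (hB : B ≤ p) (a m : ZMod p) :
    (p : ℂ) * ∑ y ∈ Ico A B, stdAddChar (a * (y : ZMod p)⁻¹ + m * (y : ZMod p)) =
      ∑ b : ZMod p, (∑ y ∈ Ico A B, stdAddChar (b * (y : ZMod p))) * kloostermanSum a (m - b) := by
  have hterm (b : ZMod p) :
      (∑ y ∈ Ico A B, stdAddChar (b * (y : ZMod p))) * kloostermanSum a (m - b) =
      ∑ y ∈ Ico A B, ∑ x : (ZMod p)ˣ, stdAddChar (a * (x : ZMod p)⁻¹ + m * (x : ZMod p)) *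
        stdAddChar (b * ((y : ZMod p) - (x : ZMod p))) := by
    rw [kloostermanSum, sum_mul_sum]
    refine sum_congr rfl fun y _ ↦ sum_congr rfl fun x _ ↦ ?_
    rw [← AddChar.map_add_eq_mul, ← AddChar.map_add_eq_mul]
    congr 1
    ring
  simp only [hterm]
  rw [sum_comm, mul_sum]
  refine sum_congr rfl fun y hy ↦ ?_
  rw [mem_Ico] at hy
  have hy0 : (y : ZMod p) ≠ 0 := by
    rw [Ne, natCast_eq_zero_iff]
    exact Nat.not_dvd_of_pos_of_lt (by omega) (by omega)
  rw [sum_comm]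
  simp only [← mul_sum, sum_stdAddChar_mul, sub_eq_zero]
  rw [sum_eq_single (Units.mk0 _ hy0)]
  · simp [mul_comm]
  · intro x _ hx
    rw [if_neg, mul_zero]
    rintro h
    exact hx (Units.ext h.symm)
  · simp

/-- Kloosterman's bound for incomplete Kloosterman sums. -/
lemma norm_sum_Ico_stdAddChar_inv_le {A B : ℕ} (hA : 1 ≤ A) (hAB : A ≤ B) (hB : B ≤ p)
    {a : ZMod p} (ha : a ≠ 0) (m : ZMod p) :
    ‖∑ y ∈ Ico A B, stdAddChar (a * (y : ZMod p)⁻¹ + m * (y : ZMod p))‖ ≤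
      5 * (p : ℝ) ^ (3 / 4 : ℝ) := by
  have hp : (0 : ℝ) < p := by exact_mod_cast (Fact.out : p.Prime).pos
  let w : ZMod p → ℝ := fun b ↦ if b = 0 then 1 else (2 * (b.valMinAbs.natAbs : ℝ))⁻¹
  have hw0 (b : ZMod p) : 0 ≤ w b := by
    simp only [w]; split_ifs <;> positivity
  have hw (b : ZMod p) : ‖∑ y ∈ Ico A B, stdAddChar (b * (y : ZMod p))‖ ≤ p * w b := by
    simp only [w]
    split_ifs with hb
    · refine (norm_sum_le _ _).trans ?_
      simp only [AddChar.norm_apply, sum_const, Nat.card_Ico, nsmul_eq_mul, mul_one]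
      exact_mod_cast (by omega : B - A ≤ p)
    · refine (norm_sum_Ico_stdAddChar_le hb hAB).trans_eq ?_
      rw [mul_inv]; ring
  have hwsum : ∑ b, w b ^ (4 / 3 : ℝ) ≤ 5 := by
    have hne : ∑ b : ZMod p with b ≠ 0, w b ^ (4 / 3 : ℝ) ≤ 4 := by
      calc ∑ b : ZMod p with b ≠ 0, w b ^ (4 / 3 : ℝ)
          ≤ ∑ b : ZMod p with b ≠ 0,
            (fun n : ℕ ↦ 1 / 2 * (n : ℝ) ^ (-(4 / 3) : ℝ)) b.valMinAbs.natAbs := by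
            refine sum_le_sum fun b hb ↦ ?_
            have hb : b ≠ 0 := by simpa using hb
            have hd := natAbs_valMinAbs_pos hb
            simp only [w, if_neg hb]
            rw [Real.inv_rpow (by positivity), Real.mul_rpow (by positivity) hd.le, mul_inv,
              Real.rpow_neg hd.le]
            gcongr
            rw [inv_le_comm₀ (by positivity) (by positivity)]
            calc (1 / 2 : ℝ)⁻¹ = (2 : ℝ) ^ (1 : ℝ) := by norm_num
              _ ≤ _ := Real.rpow_le_rpow_of_exponent_le (by norm_num) (by norm_num)
        _ ≤ 2 * ∑ n ∈ Ico 1 p, 1 / 2 * (n : ℝ) ^ (-(4 / 3) : ℝ) :=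
            sum_ne_zero_natAbs_valMinAbs_le
              (g := fun n : ℕ ↦ 1 / 2 * (n : ℝ) ^ (-(4 / 3) : ℝ)) fun n ↦ by positivity
        _ = ∑ n ∈ Ico 1 p, (n : ℝ) ^ (-(4 / 3) : ℝ) := by rw [← mul_sum]; ring
        _ ≤ 4 := sum_Ico_rpow_neg_four_thirds_le p
    rw [← sum_filter_add_sum_filter_not univ (fun b : ZMod p ↦ b = 0)]
    have h0 : ∑ b : ZMod p with b = 0, w b ^ (4 / 3 : ℝ) = 1 := by
      simp [filter_eq', w]
    rw [h0]
    linarith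
  have hK : ∑ b : ZMod p, ‖kloostermanSum a (m - b)‖ ^ (4 : ℝ) ≤ 3 * (p : ℝ) ^ (3 : ℝ) := by
    have h1 := sum_norm_kloostermanSum_pow_four_le ha
    rw [← Equiv.sum_comp (Equiv.subLeft m)] at h1
    simp only [Equiv.subLeft_apply] at h1
    exact_mod_cast h1
  have hholder : ∑ b, w b * ‖kloostermanSum a (m - b)‖ ≤
      (∑ b, w b ^ (4 / 3 : ℝ)) ^ (1 / (4 / 3) : ℝ) *
        (∑ b : ZMod p, ‖kloostermanSum a (m - b)‖ ^ (4 : ℝ)) ^ (1 / 4 : ℝ) :=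
    Real.inner_le_Lp_mul_Lq_of_nonneg univ
      (Real.holderConjugate_iff.mpr ⟨by norm_num, by norm_num⟩)
      (fun b _ ↦ hw0 b) (fun b _ ↦ norm_nonneg _)
  have hbound : ∑ b, w b * ‖kloostermanSum a (m - b)‖ ≤ 5 * (p : ℝ) ^ (3 / 4 : ℝ) := by
    calc _ ≤ (5 : ℝ) ^ (1 / (4 / 3) : ℝ) * (5 * (p : ℝ) ^ (3 : ℝ)) ^ (1 / 4 : ℝ) := by
          refine hholder.trans ?_
          have hsw : 0 ≤ ∑ b, w b ^ (4 / 3 : ℝ) :=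
            sum_nonneg fun b _ ↦ Real.rpow_nonneg (hw0 b) _
          have hp3 : (0 : ℝ) ≤ (p : ℝ) ^ (3 : ℝ) := by positivity
          gcongr
          linarith
      _ = _ := by
          rw [Real.mul_rpow (by norm_num) (by positivity), ← Real.rpow_mul hp.le, ← mul_assoc,
            ← Real.rpow_add (by norm_num)]
          norm_num
  have hcomp : (p : ℝ) * ‖∑ y ∈ Ico A B, stdAddChar (a * (y : ZMod p)⁻¹ + m * (y : ZMod p))‖ ≤
      p * ∑ b, w b * ‖kloostermanSum a (m - b)‖ := by
    calc _ = ‖(p : ℂ) * ∑ y ∈ Ico A B, stdAddChar (a * (y : ZMod p)⁻¹ + m * (y : ZMod p))‖ := by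
          rw [norm_mul, Complex.norm_natCast]
      _ ≤ ∑ b : ZMod p, p * w b * ‖kloostermanSum a (m - b)‖ := by
          rw [card_mul_sum_Ico_stdAddChar_inv hA hB]
          refine (norm_sum_le _ _).trans (sum_le_sum fun b _ ↦ ?_)
          rw [norm_mul]
          gcongr
          exact hw b
      _ = _ := by simp only [mul_sum, mul_assoc]
  exact (le_of_mul_le_mul_left hcomp hp).trans hbound

lemma sum_Ico_sum_stdAddChar_sub {L R : ℕ} (hR : R ≤ p) (z : ZMod p) :
    ∑ x ∈ Ico L R, ∑ a : ZMod p, stdAddChar (a * ((x : ZMod p) - z)) =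
      if L ≤ z.val ∧ z.val < R then (p : ℂ) else 0 := by
  simp only [sum_stdAddChar_mul, sub_eq_zero]
  have h : ∀ x ∈ Ico L R, (if (x : ZMod p) = z then (p : ℂ) else 0) =
      if z.val = x then (p : ℂ) else 0 := by
    intro x hx
    have hx : x < p := (mem_Ico.mp hx).2.trans_le hR
    refine if_congr ⟨?_, ?_⟩ rfl rfl
    · rintro rfl
      exact val_natCast_of_lt hx
    · rintro rfl
      simp
  rw [sum_congr rfl h, sum_ite_eq]
  simp only [mem_Ico]

/-- The number of points of the modular hyperbola in the region between an affine function and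
a constant is asymptotically proportional to the area of that region. -/
lemma abs_card_modInv_mem_sub_le {A B R : ℕ} {L : ℕ → ℕ} (hA : 1 ≤ A) (hAB : A ≤ B) (hB : B ≤ p)
    (hR : R ≤ p) (hL : ∀ y ∈ Ico A B, L y ≤ R) (l c : ZMod p)
    (hlin : ∀ y ∈ Ico A B, (L y : ZMod p) = l * y + c) :
    |(#{y ∈ Ico A B | L y ≤ modInv p y ∧ modInv p y < R} : ℝ) -
      (∑ y ∈ Ico A B, ((R : ℝ) - L y)) / p| ≤ 5 * (p : ℝ) ^ (3 / 4 : ℝ) * (1 + Real.log p) := by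
  have hp0 := (Fact.out : p.Prime).pos
  have hp : (0 : ℝ) < p := by exact_mod_cast hp0
  let F : ZMod p → ℂ := fun a ↦
    ∑ y ∈ Ico A B, ∑ x ∈ Ico (L y) R, stdAddChar (a * ((x : ZMod p) - (y : ZMod p)⁻¹))
  have hcount : (p : ℂ) * #{y ∈ Ico A B | L y ≤ modInv p y ∧ modInv p y < R} = ∑ a, F a := by
    simp only [F]
    rw [sum_comm, sum_congr rfl fun y _ ↦ sum_comm]
    simp only [sum_Ico_sum_stdAddChar_sub hR]
    rw [← sum_filter, sum_const, nsmul_eq_mul, mul_comm]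
    rfl
  have hzero : F 0 = ((∑ y ∈ Ico A B, ((R : ℝ) - L y) : ℝ) : ℂ) := by
    simp only [F, zero_mul, AddChar.map_zero_eq_one, sum_const, Nat.card_Ico, nsmul_eq_mul, mul_one]
    push_cast
    refine sum_congr rfl fun y hy ↦ ?_
    rw [Nat.cast_sub (hL y hy)]
  have hF (a : ZMod p) (ha : a ≠ 0) :
      ‖F a‖ ≤ 10 * (p : ℝ) ^ (3 / 4 : ℝ) * (p / 4) * (a.valMinAbs.natAbs : ℝ)⁻¹ := by
    have heq : F a = (stdAddChar (a * (R : ZMod p)) *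
          ∑ y ∈ Ico A B, stdAddChar (-a * (y : ZMod p)⁻¹ + 0 * (y : ZMod p)) -
        stdAddChar (a * c) *
          ∑ y ∈ Ico A B, stdAddChar (-a * (y : ZMod p)⁻¹ + a * l * (y : ZMod p))) *
        (stdAddChar a - 1)⁻¹ := by
      simp only [F]
      rw [mul_sum, mul_sum, ← sum_sub_distrib, sum_mul]
      refine sum_congr rfl fun y hy ↦ ?_
      have hsplit (x : ℕ) : stdAddChar (a * ((x : ZMod p) - (y : ZMod p)⁻¹)) =
          stdAddChar (-a * (y : ZMod p)⁻¹) * stdAddChar (a * (x : ZMod p)) := by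
        rw [← AddChar.map_add_eq_mul]
        congr 1
        ring
      simp only [hsplit]
      rw [← mul_sum, sum_Ico_stdAddChar ha (hL y hy), hlin y hy, ← mul_assoc, mul_sub,
        ← AddChar.map_add_eq_mul, ← AddChar.map_add_eq_mul, ← AddChar.map_add_eq_mul,
        ← AddChar.map_add_eq_mul]
      congr 3 <;> ring
    rw [heq, norm_mul, norm_inv, mul_assoc]
    gcongr
    · refine (norm_sub_le _ _).trans ?_
      rw [norm_mul, norm_mul, AddChar.norm_apply, AddChar.norm_apply, one_mul, one_mul]
      linarith [norm_sum_Ico_stdAddChar_inv_le hA hAB hB (neg_ne_zero.mpr ha) 0,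
        norm_sum_Ico_stdAddChar_inv_le hA hAB hB (neg_ne_zero.mpr ha) (a * l)]
    · exact inv_norm_stdAddChar_sub_one_le ha
  have hrest : ‖∑ a : ZMod p with a ≠ 0, F a‖ ≤
      p * (5 * (p : ℝ) ^ (3 / 4 : ℝ) * (1 + Real.log p)) := by
    calc _ ≤ ∑ a : ZMod p with a ≠ 0,
          (fun n : ℕ ↦ 10 * (p : ℝ) ^ (3 / 4 : ℝ) * (p / 4) * (n : ℝ)⁻¹) a.valMinAbs.natAbs :=
          (norm_sum_le _ _).trans (sum_le_sum fun a ha ↦ hF a (by simpa using ha))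
      _ ≤ 2 * ∑ n ∈ Ico 1 p, 10 * (p : ℝ) ^ (3 / 4 : ℝ) * (p / 4) * (n : ℝ)⁻¹ :=
          sum_ne_zero_natAbs_valMinAbs_le
            (g := fun n : ℕ ↦ 10 * (p : ℝ) ^ (3 / 4 : ℝ) * (p / 4) * (n : ℝ)⁻¹)
            fun n ↦ by positivity
      _ = p * (5 * (p : ℝ) ^ (3 / 4 : ℝ) * ∑ n ∈ Ico 1 p, (n : ℝ)⁻¹) := by
          rw [← mul_sum]; ring
      _ ≤ _ := by
          gcongr
          exact sum_Ico_inv_le_one_add_log p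
  have hsplit : ∑ a, F a = F 0 + ∑ a : ZMod p with a ≠ 0, F a := by
    rw [← sum_filter_add_sum_filter_not univ (fun b : ZMod p ↦ b = 0), filter_eq']
    simp
  refine le_of_mul_le_mul_left ?_ hp
  refine le_trans (le_of_eq ?_) hrest
  rw [← abs_of_pos hp, ← abs_mul, abs_of_pos hp, ← Real.norm_eq_abs, ← Complex.norm_real]
  congr 1
  push_cast
  rw [mul_sub, hcount, hsplit, mul_div_cancel₀ _ (by exact_mod_cast hp.ne'), hzero]
  push_cast
  ring

lemma modInv_modInv {y : ℕ} (hy : y < p) : modInv p (modInv p y) = y := by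
  simp [modInv, val_natCast_of_lt hy]

lemma modInv_pos {y : ℕ} (hy0 : 0 < y) (hy : y < p) : 0 < modInv p y := by
  rw [modInv, val_pos, Ne, inv_eq_zero, natCast_eq_zero_iff]
  exact Nat.not_dvd_of_pos_of_lt hy0 hy

lemma modInv_lt (y : ℕ) : modInv p y < p := val_lt _

/-- The reflected region of `Bminus p`, cut along the horizontal line through its middle vertex. -/
lemma card_Bminus_eq {k : ℕ} (hk : p = 2 * k + 1) :
    #(Bminus p) =
      #{y ∈ Ico ((k + 1) / 2) ((2 * k + 2) / 3) | 2 * k - 2 * y ≤ modInv p y ∧ modInv p y < k} +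
      #{y ∈ Ico ((2 * k + 2) / 3) k | y + 1 ≤ modInv p y ∧ modInv p y < k} := by
  have hp := (Fact.out : p.Prime).two_le
  rw [← card_union_of_disjoint]
  · refine card_nbij' (modInv p) (modInv p) ?_ ?_ ?_ ?_
    · intro x hx
      simp only [Bminus, coe_filter, mem_Icc, Set.mem_ofPred_eq, coe_union, Set.mem_union,
        mem_Ico] at hx ⊢
      have h := modInv_modInv (p := p) (y := x) (by omega)
      rw [h]
      omega
    · intro y hy
      simp only [Bminus, coe_filter, mem_Icc, Set.mem_ofPred_eq, coe_union, Set.mem_union,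
        mem_Ico] at hy ⊢
      have h := modInv_modInv (p := p) (y := y) (by omega)
      have h0 := modInv_pos (p := p) (y := y) (by omega) (by omega)
      rw [h]
      omega
    · intro x hx
      simp only [Bminus, coe_filter, mem_Icc, Set.mem_ofPred_eq] at hx
      exact modInv_modInv (by omega)
    · intro y hy
      simp only [coe_filter, Set.mem_ofPred_eq, coe_union, Set.mem_union, mem_Ico] at hy
      exact modInv_modInv (by omega)
  · exact disjoint_filter_filter (Ico_disjoint_Ico_consecutive _ _ _)

lemma sum_Ico_cast_eq {m n : ℕ} (hmn : m ≤ n) :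
    ∑ y ∈ Ico m n, (y : ℝ) = ((n : ℝ) * (n - 1) - m * (m - 1)) / 2 := by
  induction n, hmn using Nat.le_induction with
  | base => simp
  | succ n hmn ih =>
    rw [sum_Ico_succ_top hmn, ih]
    push_cast
    ring

lemma abs_sum_widths_sub_le {k : ℕ} (hk : 0 < k) :
    |∑ y ∈ Ico ((k + 1) / 2) ((2 * k + 2) / 3), ((k : ℝ) - (2 * k - 2 * y : ℕ)) +
      ∑ y ∈ Ico ((2 * k + 2) / 3) k, ((k : ℝ) - (y + 1 : ℕ)) - (2 * k + 1 : ℝ) ^ 2 / 48| ≤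
      2 * (k : ℝ) + 1 := by
  have h1 : ∑ y ∈ Ico ((k + 1) / 2) ((2 * k + 2) / 3), ((k : ℝ) - (2 * k - 2 * y : ℕ)) =
      ∑ y ∈ Ico ((k + 1) / 2) ((2 * k + 2) / 3), (2 * (y : ℝ) - k) := by
    refine sum_congr rfl fun y hy ↦ ?_
    rw [mem_Ico] at hy
    rw [Nat.cast_sub (by omega)]
    push_cast
    ring
  have h2 : ∑ y ∈ Ico ((2 * k + 2) / 3) k, ((k : ℝ) - (y + 1 : ℕ)) =
      ∑ y ∈ Ico ((2 * k + 2) / 3) k, ((k : ℝ) - 1 - y) := by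
    refine sum_congr rfl fun y _ ↦ ?_
    push_cast
    ring
  rw [h1, h2]
  have hAM : (k + 1) / 2 ≤ (2 * k + 2) / 3 := by omega
  have hMk : (2 * k + 2) / 3 ≤ k := by omega
  simp only [sum_sub_distrib, ← mul_sum, sum_const, Nat.card_Ico, nsmul_eq_mul]
  rw [sum_Ico_cast_eq hAM, sum_Ico_cast_eq hMk, Nat.cast_sub hAM, Nat.cast_sub hMk]
  obtain ⟨j, r, hr, rfl⟩ : ∃ j r, r < 6 ∧ k = 6 * j + r :=
    ⟨k / 6, k % 6, Nat.mod_lt _ (by norm_num), by omega⟩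
  have hA : (6 * j + r + 1) / 2 = 3 * j + (r + 1) / 2 := by omega
  have hM : (2 * (6 * j + r) + 2) / 3 = 4 * j + (2 * r + 2) / 3 := by omega
  rw [hA, hM]
  have hj : (0 : ℝ) ≤ j := j.cast_nonneg
  rw [abs_le]
  interval_cases r <;> norm_num <;> constructor <;> nlinarith

lemma abs_card_Bminus_sub_le {k : ℕ} (hk : p = 2 * k + 1) :
    |(#(Bminus p) : ℝ) - p / 48| ≤ 10 * (p : ℝ) ^ (3 / 4 : ℝ) * (1 + Real.log p) + 1 := by
  have hp2 := (Fact.out : p.Prime).two_le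
  have hp : (0 : ℝ) < p := by exact_mod_cast (Fact.out : p.Prime).pos
  have hk0 : 0 < k := by omega
  have h1 := abs_card_modInv_mem_sub_le (p := p) (A := (k + 1) / 2) (B := (2 * k + 2) / 3)
    (R := k) (L := fun y ↦ 2 * k - 2 * y) (by omega) (by omega) (by omega) (by omega)
    (fun y hy ↦ by rw [mem_Ico] at hy; omega) (-2) (2 * k) (fun y hy ↦ by
      rw [mem_Ico] at hy
      rw [Nat.cast_sub (by omega)]
      push_cast
      ring)
  have h2 := abs_card_modInv_mem_sub_le (p := p) (A := (2 * k + 2) / 3) (B := k)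
    (R := k) (L := fun y ↦ y + 1) (by omega) (by omega) (by omega) (by omega)
    (fun y hy ↦ by rw [mem_Ico] at hy; omega) 1 1 (fun y _ ↦ by push_cast; ring)
  have hmain := abs_sum_widths_sub_le hk0
  have hpk : (p : ℝ) = 2 * k + 1 := by rw [hk]; push_cast; ring
  rw [← hpk] at hmain
  rw [card_Bminus_eq hk]
  push_cast
  set C₁ : ℝ := (#{y ∈ Ico ((k + 1) / 2) ((2 * k + 2) / 3) |
    2 * k - 2 * y ≤ modInv p y ∧ modInv p y < k} : ℝ)
  set C₂ : ℝ := (#{y ∈ Ico ((2 * k + 2) / 3) k | y + 1 ≤ modInv p y ∧ modInv p y < k} : ℝ)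
  set T₁ : ℝ := ∑ y ∈ Ico ((k + 1) / 2) ((2 * k + 2) / 3), ((k : ℝ) - (2 * k - 2 * y : ℕ))
  set T₂ : ℝ := ∑ y ∈ Ico ((2 * k + 2) / 3) k, ((k : ℝ) - (y + 1 : ℕ))
  have harea : |(T₁ + T₂) / p - p / 48| ≤ 1 := by
    rw [show (T₁ + T₂) / p - p / 48 = (T₁ + T₂ - (p : ℝ) ^ 2 / 48) / p by field_simp,
      abs_div, abs_of_pos hp, div_le_one hp]
    exact hmain
  calc |C₁ + C₂ - p / 48| = |(C₁ - T₁ / p) + (C₂ - T₂ / p) + ((T₁ + T₂) / p - p / 48)| := by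
        congr 1; ring
    _ ≤ |C₁ - T₁ / p| + |C₂ - T₂ / p| + |(T₁ + T₂) / p - p / 48| := abs_add_three _ _ _
    _ ≤ _ := by linarith

end KloostermanSums

theorem stmt_6 (p : ℕ) (hp : p.Prime) :
    |((Bminus p).card : ℝ) - (p : ℝ) / 48| ≤ 12 * (p : ℝ) ^ ((3 : ℝ) / 4) * Real.log p := by
  have : Fact p.Prime := ⟨hp⟩
  have hp0 : (0 : ℝ) < p := by exact_mod_cast hp.pos
  have hp2 : (2 : ℝ) ≤ p := by exact_mod_cast hp.two_le
  have hlog2 := Real.log_two_gt_d9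
  rcases lt_or_ge p 4096 with hlt | hge
  · have hlt : (p : ℝ) ≤ (8 : ℝ) ^ (4 : ℝ) := by
      norm_num
      exact_mod_cast hlt.le
    have hcard : ((Bminus p).card : ℝ) ≤ p := by
      exact_mod_cast (Finset.card_filter_le _ _).trans (by simp)
    have hroot : (p : ℝ) ^ ((1 : ℝ) / 4) ≤ 8 := by
      calc _ ≤ ((8 : ℝ) ^ (4 : ℝ)) ^ ((1 : ℝ) / 4) := by gcongr
        _ = 8 := by rw [← Real.rpow_mul (by norm_num)]; norm_num
    have hlog : 8 ≤ 12 * Real.log p := by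
      have := Real.log_le_log two_pos hp2
      linarith
    calc |((Bminus p).card : ℝ) - p / 48| ≤ p := by
          rw [abs_le]
          constructor <;> linarith [(Nat.cast_nonneg _ : (0 : ℝ) ≤ (Bminus p).card)]
      _ = (p : ℝ) ^ ((3 : ℝ) / 4) * (p : ℝ) ^ ((1 : ℝ) / 4) := by
          rw [← Real.rpow_add hp0]; norm_num
      _ ≤ (p : ℝ) ^ ((3 : ℝ) / 4) * (12 * Real.log p) := by
          gcongr
          exact hroot.trans hlog
      _ = _ := by ring
  · obtain ⟨k, hk⟩ := hp.odd_of_ne_two (by omega)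
    have hlog : 8 ≤ Real.log p := by
      calc (8 : ℝ) ≤ Real.log ((2 : ℝ) ^ 12) := by
            rw [Real.log_pow]; push_cast; linarith
        _ ≤ _ := Real.log_le_log (by norm_num) (by norm_num; exact_mod_cast hge)
    have hone : 1 ≤ (p : ℝ) ^ ((3 : ℝ) / 4) :=
      Real.one_le_rpow (by linarith) (by norm_num)
    have := abs_card_Bminus_sub_le hk
    nlinarith
end
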